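/- Under Assumptions 1 and 2, for every fixed ε ∈ (0,1), the smoothed normalized estimator Z̃_n = √(1−ε)·Z_n + √ε·Z, where Z ~ N(0,1) is independent of Z_n, satisfies lim_{n→∞} D(Z̃_n ‖ Z) = 0, where D(·‖·) is the Kullback–Leibler divergence between the law of Z̃_n and the standard Gaussian law N(0,1). -/

import Mathlib

open MeasureTheory ProbabilityTheory Filter Real Set

/-- A real random variable has sub-Gaussian tails. -/
def SubGaussianTail {Ω : Type*} [MeasurableSpace Ω] (P : Measure Ω) (W : Ω → ℝ) : Prop :=
  ∃ C > 0, ∃ c > 0, ∀ t > 0,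
    P {ω | t ≤ |W ω|} ≤ ENNReal.ofReal (C * Real.exp (-c * t ^ 2))

/-- A real random variable has sub-exponential tails. -/
def SubExponentialTail {Ω : Type*} [MeasurableSpace Ω] (P : Measure Ω) (W : Ω → ℝ) : Prop :=
  ∃ C > 0, ∃ c > 0, ∀ t > 0,
    P {ω | t ≤ |W ω|} ≤ ENNReal.ofReal (C * Real.exp (-c * t))


open scoped Classical

/-- The Kullback–Leibler divergence `D(ν ‖ γ) = ∫ log (dν/dγ) dν` of a measure `ν` on ℝ
from a measure `γ`, as an extended real number, interpreted as `+∞` when `ν` is not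
absolutely continuous with respect to `γ` or the integral is not defined/infinite.
When `ν` and `γ` have densities `f_ν` and `f_γ` with respect to Lebesgue measure this
coincides with `∫ f_ν(x) log (f_ν(x) / f_γ(x)) dx`. -/
noncomputable def klDiv (ν γ : Measure ℝ) : EReal :=
  if ν ≪ γ ∧ Integrable (MeasureTheory.llr ν γ) ν
  then ((∫ x, MeasureTheory.llr ν γ x ∂ν : ℝ) : EReal) else ⊤

lemma expInt_of_tail {Ω : Type*} [MeasurableSpace Ω] (P : Measure Ω) [IsProbabilityMeasure P]
    (Y : Ω → ℝ) (hY : AEMeasurable Y P) (C c a : ℝ) (hC : 0 < C) (ha : 0 < a) (hac : a < c)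
    (htail : ∀ t > 0, P {ω | t ≤ |Y ω|} ≤ ENNReal.ofReal (C * Real.exp (-c * t))) :
    Integrable (fun ω => Real.exp (a * |Y ω|)) P := by
  have hc : 0 < c := ha.trans hac
  have hmeas : AEMeasurable (fun ω => Real.exp (a * |Y ω|)) P := by fun_prop
  refine ⟨hmeas.aestronglyMeasurable, ?_⟩
  rw [hasFiniteIntegral_iff_ofReal (ae_of_all _ fun ω => (Real.exp_pos _).le)]
  set C' := max C 1 with hC'
  have hC'pos : 0 < C' := lt_of_lt_of_le hC (le_max_left _ _)
  have htail' : ∀ k : ℕ, P {ω | (k : ℝ) ≤ |Y ω|} ≤ ENNReal.ofReal (C' * Real.exp (-c * k)) := by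
    intro k
    rcases Nat.eq_zero_or_pos k with rfl | hk
    · refine prob_le_one.trans ?_
      rw [← ENNReal.ofReal_one]
      apply ENNReal.ofReal_le_ofReal
      simp [hC']
    · refine (htail k (by exact_mod_cast hk)).trans ?_
      apply ENNReal.ofReal_le_ofReal
      exact mul_le_mul_of_nonneg_right (le_max_left _ _) (Real.exp_pos _).le
  have hset : ∀ k : ℕ, NullMeasurableSet {ω | (k : ℝ) ≤ |Y ω|} P := fun k =>
    nullMeasurableSet_le aemeasurable_const (by fun_prop)
  have hpt : ∀ ω, ENNReal.ofReal (Real.exp (a * |Y ω|)) ≤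
      ∑' k : ℕ, {ω | (k : ℝ) ≤ |Y ω|}.indicator (fun _ => ENNReal.ofReal (Real.exp (a * (k + 1)))) ω := by
    intro ω
    have h1 := Nat.floor_le (abs_nonneg (Y ω))
    have h2 := (Nat.lt_floor_add_one (|Y ω|)).le
    refine le_trans ?_ (ENNReal.le_tsum (⌊|Y ω|⌋₊))
    rw [Set.indicator_of_mem (by exact h1)]
    apply ENNReal.ofReal_le_ofReal
    apply Real.exp_le_exp.2
    gcongr
  calc ∫⁻ ω, ENNReal.ofReal (Real.exp (a * |Y ω|)) ∂P
      ≤ ∫⁻ ω, ∑' k : ℕ, {ω | (k : ℝ) ≤ |Y ω|}.indicator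
          (fun _ => ENNReal.ofReal (Real.exp (a * (k + 1)))) ω ∂P := lintegral_mono hpt
    _ = ∑' k : ℕ, ∫⁻ ω, {ω | (k : ℝ) ≤ |Y ω|}.indicator
          (fun _ => ENNReal.ofReal (Real.exp (a * (k + 1)))) ω ∂P :=
        lintegral_tsum fun k => aemeasurable_const.indicator₀ (hset k)
    _ ≤ ∑' k : ℕ, ENNReal.ofReal (C' * Real.exp a * (Real.exp (a - c)) ^ k) := by
        refine ENNReal.tsum_le_tsum fun k => ?_
        rw [lintegral_indicator₀ (hset k), lintegral_const, Measure.restrict_apply_univ]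
        refine (mul_le_mul_right (htail' k) _).trans ?_
        rw [← ENNReal.ofReal_mul (Real.exp_pos _).le]
        apply ENNReal.ofReal_le_ofReal
        rw [← Real.exp_nat_mul, mul_comm, mul_assoc, mul_assoc, ← Real.exp_add, ← Real.exp_add]
        apply le_of_eq; congr 2; ring
    _ < ⊤ := by
        have hs : Summable fun k : ℕ => C' * Real.exp a * (Real.exp (a - c)) ^ k :=
          (summable_geometric_of_lt_one (Real.exp_pos _).le
            (Real.exp_lt_one_iff.2 (by linarith))).mul_left _
        exact hs.tsum_ofReal_lt_top

lemma expInt_of_subE {Ω : Type*} [MeasurableSpace Ω] (P : Measure Ω) [IsProbabilityMeasure P]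
    (Y W : Ω → ℝ) (hY : AEMeasurable Y P) (hYW : ∀ᵐ ω ∂P, |Y ω| ≤ |W ω|)
    (h : SubExponentialTail P W) :
    ∃ a > 0, Integrable (fun ω => Real.exp (a * |Y ω|)) P := by
  obtain ⟨C, hC, c, hc, ht⟩ := h
  refine ⟨c / 2, by positivity, expInt_of_tail P Y hY C c (c/2) hC (by positivity) (by linarith) ?_⟩
  intro t htpos
  refine le_trans (measure_mono_ae ?_) (ht t htpos)
  filter_upwards [hYW] with ω hω h
  exact le_trans h hω

lemma expInt_of_subG {Ω : Type*} [MeasurableSpace Ω] (P : Measure Ω) [IsProbabilityMeasure P]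
    (Y W : Ω → ℝ) (hY : AEMeasurable Y P) (hYW : ∀ᵐ ω ∂P, |Y ω| ≤ |W ω|)
    (h : SubGaussianTail P W) (a : ℝ) (ha : 0 < a) :
    Integrable (fun ω => Real.exp (a * |Y ω|)) P := by
  obtain ⟨C, hC, c, hc, ht⟩ := h
  refine expInt_of_tail P Y hY (C * Real.exp ((a+1)^2/(4*c))) (a+1) a (by positivity) ha
    (by linarith) ?_
  intro t htpos
  refine le_trans (le_trans (measure_mono_ae ?_) (ht t htpos)) ?_
  · filter_upwards [hYW] with ω hω h
    exact le_trans h hω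
  · apply ENNReal.ofReal_le_ofReal
    rw [mul_assoc, ← Real.exp_add]
    gcongr
    have : (a+1)^2/(4*c) + -(a+1)*t - (-c * t^2) = (2*c*t - (a+1))^2/(4*c) := by
      field_simp; ring
    have h2 : 0 ≤ (2*c*t - (a+1))^2/(4*c) := by positivity
    linarith

lemma chernoff {Ω 𝓧 : Type*} [MeasurableSpace Ω] [MeasurableSpace 𝓧] (P : Measure Ω)
    [IsProbabilityMeasure P] (ν : Measure 𝓧) (X : ℕ → Ω → 𝓧) (hXm : ∀ i, Measurable (X i))
    (hXi : iIndepFun X P) (hXl : ∀ i, Measure.map (X i) P = ν)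
    (Y : 𝓧 → ℝ) (hY : Measurable Y)
    (hexp : ∃ a > 0, Integrable (fun x => Real.exp (a * |Y x|)) ν) (hneg : ∫ x, Y x ∂ν < 0) :
    ∃ ρ : ℝ, 0 ≤ ρ ∧ ρ < 1 ∧ ∀ n : ℕ,
      P {ω | 0 ≤ ∑ i ∈ Finset.range n, Y (X i ω)} ≤ ENNReal.ofReal (ρ ^ n) := by
  have : IsProbabilityMeasure ν := by
    rw [← hXl 0]; exact Measure.isProbabilityMeasure_map (hXm 0).aemeasurable
  obtain ⟨a, ha, hitg⟩ := hexp
  have hmem : ∀ t, |t| ≤ a → Integrable (fun x => Real.exp (t * Y x)) ν := by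
    intro t ht
    refine hitg.mono' (by fun_prop) (ae_of_all _ fun x => ?_)
    rw [Real.norm_eq_abs, abs_of_pos (Real.exp_pos _)]
    apply Real.exp_le_exp.2
    refine (le_abs_self _).trans ?_
    rw [abs_mul]
    exact mul_le_mul_of_nonneg_right ht (abs_nonneg _)
  have h0 : (0:ℝ) ∈ interior (integrableExpSet Y ν) := by
    rw [mem_interior]
    refine ⟨Set.Ioo (-a) a, ?_, isOpen_Ioo, by constructor <;> linarith⟩
    intro t ht
    exact hmem t (abs_le.2 ⟨ht.1.le, ht.2.le⟩)
  have hd : HasDerivAt (mgf Y ν) (∫ x, Y x ∂ν) 0 := by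
    simpa using hasDerivAt_mgf h0
  have hev : ∀ᶠ t in nhdsWithin (0:ℝ) (Set.Ioi 0), mgf Y ν t < 1 := by
    have := hd.tendsto_slope_zero_right
    have h2 := this.eventually (gt_mem_nhds hneg)
    filter_upwards [h2, self_mem_nhdsWithin] with t ht htp
    simp only [zero_add, mgf_zero, smul_eq_mul] at ht
    have htp' : (0:ℝ) < t := htp
    have : t⁻¹ > 0 := by positivity
    by_contra hcon
    push Not at hcon
    have := mul_nonneg this.le (sub_nonneg.2 hcon)
    linarith
  have hev2 : ∀ᶠ t in nhdsWithin (0:ℝ) (Set.Ioi 0), t < a :=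
    mem_nhdsWithin_of_mem_nhds (gt_mem_nhds ha)
  obtain ⟨t, ht1, ht2, ht3⟩ := (hev.and (hev2.and self_mem_nhdsWithin)).exists
  have ht3 : 0 < t := ht3
  refine ⟨mgf Y ν t, mgf_nonneg, ht1, fun n => ?_⟩
  have hident : ∀ i j, IdentDistrib (fun ω => Y (X i ω)) (fun ω => Y (X j ω)) P P := by
    intro i j
    refine ⟨(hY.comp (hXm i)).aemeasurable, (hY.comp (hXm j)).aemeasurable, ?_⟩
    have : ∀ i, Measure.map (fun ω => Y (X i ω)) P = Measure.map Y ν := by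
      intro i; rw [← hXl i, Measure.map_map hY (hXm i)]; rfl
    rw [this, this]
  have hind : iIndepFun (fun i ω => Y (X i ω)) P := hXi.comp (fun _ => Y) (fun _ => hY)
  have hmg : mgf (fun ω => Y (X 0 ω)) P t = mgf Y ν t := by
    rw [← hXl 0, mgf_map (hXm 0).aemeasurable]
    · rfl
    · rw [hXl 0]; exact (hmem t (by rw [abs_of_pos ht3]; exact ht2.le)).aestronglyMeasurable
  have hsum := mgf_sum_of_identDistrib (s := Finset.range n) (j := 0)
     (fun i => hY.comp (hXm i)) hind
    (by intro i hi j hj; exact hident i j)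
  have hint1 : ∀ i, Integrable (fun ω => Real.exp (t * Y (X i ω))) P := by
    intro i
    have := hmem t (by rw [abs_of_pos ht3]; exact ht2.le)
    rw [← hXl i] at this
    exact this.comp_measurable (hXm i)
  have hintS : Integrable (fun ω => Real.exp (t * (∑ i ∈ Finset.range n, fun ω => Y (X i ω)) ω)) P :=
    hind.integrable_exp_mul_sum (fun i => hY.comp (hXm i)) (fun i _ => hint1 i)
  have hb := measure_ge_le_exp_mul_mgf (μ := P) (X := ∑ i ∈ Finset.range n, fun ω => Y (X i ω))
    0 ht3.le hintS
  have hmg2 : mgf (∑ i ∈ Finset.range n, fun ω => Y (X i ω)) P t = mgf Y ν t ^ n := by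
    rcases Nat.eq_zero_or_pos n with rfl | hn
    · simp
    · have := hsum (by simpa using hn) t
      rw [Finset.card_range] at this
      rw [← hmg]
      exact this
  rw [hmg2] at hb
  simp only [mul_zero, Real.exp_zero, one_mul, Finset.sum_apply] at hb
  rw [← ENNReal.ofReal_toReal (measure_ne_top P {ω | 0 ≤ ∑ i ∈ Finset.range n, Y (X i ω)})]
  exact ENNReal.ofReal_le_ofReal (by simpa [Measure.real] using hb)


lemma gdct {α : Type*} [MeasurableSpace α] (m : Measure α) (q g : ℕ → α → ℝ) (g0 : α → ℝ)
    (hq : ∀ᶠ n in atTop, Integrable (q n) m) (hg : ∀ n, Integrable (g n) m)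
    (hg0 : Integrable g0 m)
    (hg0n : ∀ x, 0 ≤ g0 x)
    (hqg : ∀ᶠ n in atTop, ∀ x, |q n x| ≤ g n x)
    (hql : ∀ᵐ x ∂m, Tendsto (fun n => q n x) atTop (nhds 0))
    (hgl : ∀ᵐ x ∂m, Tendsto (fun n => g n x) atTop (nhds (g0 x)))
    (hI : Tendsto (fun n => ∫ x, g n x ∂m) atTop (nhds (∫ x, g0 x ∂m))) :
    Tendsto (fun n => ∫ x, q n x ∂m) atTop (nhds 0) := by
  have h1 : Tendsto (fun n => ∫ x, min |q n x| (g0 x) ∂m) atTop (nhds (∫ x, (0:ℝ) ∂m)) := by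
    apply tendsto_integral_filter_of_dominated_convergence g0
    · filter_upwards [hq] with n hn
      exact (hn.abs.aestronglyMeasurable.inf hg0.aestronglyMeasurable)
    · refine Eventually.of_forall fun n => ae_of_all _ fun x => ?_
      rw [Real.norm_eq_abs, abs_of_nonneg (le_min (abs_nonneg _) (hg0n x))]
      exact min_le_right _ _
    · exact hg0
    · filter_upwards [hql] with x hx
      have := (hx.abs).min (tendsto_const_nhds (x := g0 x))
      simpa [hg0n x] using this
  have h2 : Tendsto (fun n => ∫ x, min |g n x| (g0 x) ∂m) atTop (nhds (∫ x, g0 x ∂m)) := by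
    apply tendsto_integral_filter_of_dominated_convergence g0
    · refine Eventually.of_forall fun n => ?_
      exact ((hg n).abs.aestronglyMeasurable.inf hg0.aestronglyMeasurable)
    · refine Eventually.of_forall fun n => ae_of_all _ fun x => ?_
      rw [Real.norm_eq_abs, abs_of_nonneg (le_min (abs_nonneg _) (hg0n x))]
      exact min_le_right _ _
    · exact hg0
    · filter_upwards [hgl] with x hx
      have := (hx.abs).min (tendsto_const_nhds (x := g0 x))
      simpa [hg0n x, abs_of_nonneg] using this
  have h3 := h1.add (hI.sub h2)
  simp only [integral_zero, sub_self, add_zero] at h3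
  refine squeeze_zero_norm' ?_ h3
  filter_upwards [hq, hqg] with n hn hng
  have ha : Integrable (fun x => min |q n x| (g0 x)) m := hn.abs.inf hg0
  have hb : Integrable (fun x => min |g n x| (g0 x)) m := (hg n).abs.inf hg0
  calc ‖∫ x, q n x ∂m‖ ≤ ∫ x, |q n x| ∂m := norm_integral_le_integral_norm _
    _ ≤ ∫ x, (min |q n x| (g0 x) + (g n x - min |g n x| (g0 x))) ∂m := by
        refine integral_mono hn.abs (ha.add ((hg n).sub hb)) fun x => ?_
        have h1 := hng x
        have h0 := abs_nonneg (q n x)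
        have h2 : |g n x| = g n x := abs_of_nonneg (h0.trans h1)
        simp only [h2]
        rcases le_total (|q n x|) (g0 x) with h | h
        · have := min_le_left (g n x) (g0 x)
          rw [min_eq_left h]; linarith
        · have := min_le_right (g n x) (g0 x)
          rw [min_eq_right h]; linarith
    _ = _ := by
        rw [← integral_sub (hg n) hb]
        exact integral_add ha ((hg n).sub hb)

lemma klDiv_withDensity (p : ℝ → ℝ) (hp : Measurable p) (hpos : ∀ x, 0 < p x)
    (hi : Integrable (fun x => p x * Real.log (p x / gaussianPDFReal 0 1 x))) :
    klDiv (volume.withDensity (fun x => ENNReal.ofReal (p x))) (gaussianReal 0 1) =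
      ((∫ x, p x * Real.log (p x / gaussianPDFReal 0 1 x) : ℝ) : EReal) := by
  set ν := (volume : Measure ℝ).withDensity (fun x => ENNReal.ofReal (p x)) with hν
  have h1 : (1 : NNReal) ≠ 0 := one_ne_zero
  have hac : ν ≪ gaussianReal 0 1 :=
    (withDensity_absolutelyContinuous _ _).trans (gaussianReal_absolutelyContinuous' 0 h1)
  have hνeq : ν = (gaussianReal 0 1).withDensity
      (fun x => ENNReal.ofReal (p x / gaussianPDFReal 0 1 x)) := by
    rw [gaussianReal_of_var_ne_zero 0 h1, ← withDensity_mul _ (measurable_gaussianPDF 0 1)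
      (by have := measurable_gaussianPDFReal 0 1; fun_prop), hν]
    congr 1
    ext x
    have := gaussianPDFReal_pos 0 1 x h1
    rw [Pi.mul_apply, gaussianPDF, ← ENNReal.ofReal_mul this.le]
    congr 1
    field_simp
  have hllr : MeasureTheory.llr ν (gaussianReal 0 1) =ᵐ[ν]
      fun x => Real.log (p x / gaussianPDFReal 0 1 x) := by
    have h2 : ν.rnDeriv (gaussianReal 0 1) =ᵐ[gaussianReal 0 1]
        fun x => ENNReal.ofReal (p x / gaussianPDFReal 0 1 x) := by
      rw [hνeq]
      exact Measure.rnDeriv_withDensity _ (by have := measurable_gaussianPDFReal 0 1; fun_prop)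
    filter_upwards [hac.ae_le h2] with x hx
    rw [MeasureTheory.llr, hx, ENNReal.toReal_ofReal]
    exact div_nonneg (hpos x).le (gaussianPDFReal_nonneg 0 1 x)
  have hitg : Integrable (MeasureTheory.llr ν (gaussianReal 0 1)) ν := by
    rw [integrable_congr hllr, hν, integrable_withDensity_iff_integrable_smul' (by fun_prop)
      (ae_of_all _ fun x => ENNReal.ofReal_lt_top)]
    refine hi.congr (ae_of_all _ fun x => ?_)
    simp [ENNReal.toReal_ofReal (hpos x).le]
  rw [klDiv, if_pos ⟨hac, hitg⟩, integral_congr_ae hllr, hν,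
    integral_withDensity_eq_integral_toReal_smul (by fun_prop)
      (ae_of_all _ fun x => ENNReal.ofReal_lt_top)]
  congr 1
  refine integral_congr_ae (ae_of_all _ fun x => ?_)
  simp [ENNReal.toReal_ofReal (hpos x).le]

lemma kl_tendsto (p : ℕ → ℝ → ℝ) (hp : ∀ n, Measurable (p n)) (hpos : ∀ n x, 0 < p n x)
    (M : ℝ) (hM : ∀ n x, p n x ≤ M) (c : ℝ) (hc : ∀ᶠ n in atTop, ∀ x, -(c * (1 + x ^ 2)) ≤ Real.log (p n x))
    (hi : ∀ n, Integrable (fun x => (1 + x ^ 2) * p n x))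
    (hlim : ∀ᵐ x, Tendsto (fun n => p n x) atTop (nhds (gaussianPDFReal 0 1 x)))
    (hI : Tendsto (fun n => ∫ x, (1 + x ^ 2) * p n x) atTop
      (nhds (∫ x, (1 + x ^ 2) * gaussianPDFReal 0 1 x))) :
    Tendsto (fun n => klDiv (volume.withDensity (fun x => ENNReal.ofReal (p n x)))
      (gaussianReal 0 1)) atTop (nhds (0 : EReal)) := by
  have hMpos : 0 < M := (hpos 0 0).trans_le (hM 0 0)
  set A : ℝ := |c| + |Real.log M| + |Real.log (Real.sqrt (2 * π))| + 1 with hA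
  have hφ : ∀ x, Real.log (gaussianPDFReal 0 1 x) = - Real.log (Real.sqrt (2 * π)) - x ^ 2 / 2 := by
    intro x
    rw [gaussianPDFReal, Real.log_mul (by positivity) (Real.exp_pos _).ne', Real.log_exp,
      Real.log_inv]
    simp; ring
  have h1 : (1 : NNReal) ≠ 0 := one_ne_zero
  have hbound : ∀ᶠ n in atTop, ∀ x, |p n x * Real.log (p n x / gaussianPDFReal 0 1 x)| ≤
      A * ((1 + x ^ 2) * p n x) := by
    filter_upwards [hc] with n hn x
    rw [abs_mul, abs_of_pos (hpos n x), Real.log_div (hpos n x).ne' (gaussianPDFReal_pos 0 1 x h1).ne',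
      hφ]
    have hup : Real.log (p n x) ≤ |Real.log M| :=
      (Real.log_le_log (hpos n x) (hM n x)).trans (le_abs_self _)
    have hlo := hn x
    have hx : 0 ≤ x ^ 2 := sq_nonneg x
    have e1 : c * (1 + x ^ 2) ≤ |c| * (1 + x ^ 2) :=
      mul_le_mul_of_nonneg_right (le_abs_self c) (by positivity)
    have e2 := le_abs_self (Real.log (Real.sqrt (2 * π)))
    have e3 := neg_abs_le (Real.log (Real.sqrt (2 * π)))
    have e4 := mul_nonneg (abs_nonneg c) hx
    have e5 := mul_nonneg (abs_nonneg (Real.log M)) hx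
    have e6 := mul_nonneg (abs_nonneg (Real.log (Real.sqrt (2 * π)))) hx
    have e7 := abs_nonneg c
    have e8 := abs_nonneg (Real.log M)
    have : |Real.log (p n x) - (-Real.log (Real.sqrt (2 * π)) - x ^ 2 / 2)| ≤ A * (1 + x ^ 2) := by
      rw [abs_le, hA]
      constructor <;> nlinarith
    calc _ ≤ p n x * (A * (1 + x ^ 2)) := mul_le_mul_of_nonneg_left this (hpos n x).le
      _ = _ := by ring
  have hφm := measurable_gaussianPDFReal 0 1
  have hqi : ∀ᶠ n in atTop, Integrable (fun x => p n x * Real.log (p n x / gaussianPDFReal 0 1 x)) := by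
    filter_upwards [hbound] with n hn
    refine ((hi n).const_mul A).mono' ?_ (ae_of_all _ fun x => ?_)
    · have := hp n
      exact Measurable.aestronglyMeasurable (by fun_prop)
    · rw [Real.norm_eq_abs]; exact hn x
  have hφi : Integrable (fun x => (1 + x ^ 2) * gaussianPDFReal 0 1 x) := by
    have h2 : Integrable (fun x : ℝ => 1 + x ^ 2) (gaussianReal 0 1) := by
      refine (integrable_const _).add ?_
      have := (memLp_id_gaussianReal (μ := 0) (v := 1) 2).integrable_sq
      simpa using this
    rw [gaussianReal_of_var_ne_zero 0 h1, integrable_withDensity_iff_integrable_smul'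
      (measurable_gaussianPDF 0 1) (ae_of_all _ fun x => gaussianPDF_lt_top)] at h2
    refine h2.congr (ae_of_all _ fun x => ?_)
    simp [toReal_gaussianPDF, mul_comm]
  have key := gdct volume (fun n x => p n x * Real.log (p n x / gaussianPDFReal 0 1 x))
    (fun n x => A * ((1 + x ^ 2) * p n x)) (fun x => A * ((1 + x ^ 2) * gaussianPDFReal 0 1 x))
    hqi (fun n => (hi n).const_mul A) (hφi.const_mul A)
    (fun x => by have := gaussianPDFReal_nonneg 0 1 x; positivity) hbound
    (by
      filter_upwards [hlim] with x hx
      have hφp := gaussianPDFReal_pos 0 1 x h1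
      have h2 : Tendsto (fun n => p n x / gaussianPDFReal 0 1 x) atTop (nhds 1) := by
        simpa [hφp.ne'] using hx.div_const (gaussianPDFReal 0 1 x)
      have h3 := h2.log one_ne_zero
      simpa using hx.mul h3)
    (by
      filter_upwards [hlim] with x hx
      exact (hx.const_mul _).const_mul _)
    (by
      simp_rw [integral_const_mul]
      exact hI.const_mul A)
  have hcoe : Tendsto (fun n => ((∫ x, p n x * Real.log (p n x / gaussianPDFReal 0 1 x) : ℝ) : EReal))
      atTop (nhds ((0:ℝ) : EReal)) := continuous_coe_real_ereal.continuousAt.tendsto.comp key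
  rw [EReal.coe_zero] at hcoe
  refine hcoe.congr' ?_
  filter_upwards [hqi] with n hn
  exact (klDiv_withDensity (p n) (hp n) (hpos n) hn).symm


noncomputable def smPdf (ε : ℝ) (κ : Measure ℝ) (x : ℝ) : ℝ :=
  ∫ z, gaussianPDFReal (Real.sqrt (1 - ε) * z) ε.toNNReal x ∂κ

noncomputable def smLaw (ε : ℝ) (κ : Measure ℝ) : Measure ℝ :=
  (κ.prod (gaussianReal 0 1)).map (fun p => Real.sqrt (1 - ε) * p.1 + Real.sqrt ε * p.2)

lemma gpdf_le (m : ℝ) (v : NNReal) (x : ℝ) : gaussianPDFReal m v x ≤ (Real.sqrt (2 * π * v))⁻¹ := by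
  rw [gaussianPDFReal]
  refine mul_le_of_le_one_right (by positivity) ?_
  rw [Real.exp_le_one_iff]
  have : 0 ≤ (x - m) ^ 2 / (2 * v) := by positivity
  rw [neg_div]; linarith

lemma gpdf_int (ε : ℝ) (κ : Measure ℝ) [IsProbabilityMeasure κ] (x : ℝ) :
    Integrable (fun z => gaussianPDFReal (Real.sqrt (1 - ε) * z) ε.toNNReal x) κ := by
  refine Integrable.of_bound (C := (Real.sqrt (2 * π * ε.toNNReal))⁻¹) ?_ (ae_of_all _ fun z => ?_)
  · refine Measurable.aestronglyMeasurable ?_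
    unfold gaussianPDFReal; fun_prop
  · rw [Real.norm_eq_abs, abs_of_nonneg (gaussianPDFReal_nonneg _ _ _)]
    exact gpdf_le _ _ _

lemma smPdf_meas (ε : ℝ) (κ : Measure ℝ) [IsProbabilityMeasure κ] : Measurable (smPdf ε κ) := by
  have : StronglyMeasurable (Function.uncurry fun x z => gaussianPDFReal (Real.sqrt (1 - ε) * z) ε.toNNReal x) := by
    refine Measurable.stronglyMeasurable ?_
    unfold gaussianPDFReal Function.uncurry; fun_prop
  exact this.integral_prod_right.measurable

lemma smLaw_eq (ε : ℝ) (hε : ε ∈ Set.Ioo (0:ℝ) 1) (κ : Measure ℝ) [IsProbabilityMeasure κ] :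
    smLaw ε κ = volume.withDensity (fun x => ENNReal.ofReal (smPdf ε κ x)) := by
  have hv : ε.toNNReal ≠ 0 := by simp [hε.1]
  ext A hA
  rw [smLaw, Measure.map_apply (by fun_prop) hA, Measure.prod_apply (by measurability),
    withDensity_apply _ hA]
  have h1 : ∀ z, (gaussianReal 0 1) (Prod.mk z ⁻¹' ((fun p : ℝ × ℝ =>
      Real.sqrt (1 - ε) * p.1 + Real.sqrt ε * p.2) ⁻¹' A)) =
      ∫⁻ x in A, gaussianPDF (Real.sqrt (1 - ε) * z) ε.toNNReal x := by
    intro z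
    rw [← gaussianReal_apply _ hv]
    have : gaussianReal (Real.sqrt (1 - ε) * z) ε.toNNReal =
        ((gaussianReal 0 1).map (Real.sqrt ε * ·)).map (Real.sqrt (1 - ε) * z + ·) := by
      rw [gaussianReal_map_const_mul, gaussianReal_map_const_add]
      congr 1
      · simp
      · ext; simp [Real.sq_sqrt hε.1.le, hε.1.le]
    rw [this, Measure.map_map (by fun_prop) (by fun_prop), Measure.map_apply (by fun_prop) hA]
    rfl
  simp_rw [h1]
  rw [lintegral_lintegral_swap]
  · refine lintegral_congr fun x => ?_
    rw [smPdf, ofReal_integral_eq_lintegral_ofReal (gpdf_int ε κ x)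
      (ae_of_all _ fun z => gaussianPDFReal_nonneg _ _ _)]
    rfl
  · refine Measurable.aemeasurable ?_
    unfold gaussianPDF gaussianPDFReal Function.uncurry; fun_prop

lemma smLaw_gauss (ε : ℝ) (hε : ε ∈ Set.Ioo (0:ℝ) 1) :
    smLaw ε (gaussianReal 0 1) = gaussianReal 0 1 := by
  have h1 : ((gaussianReal 0 1).map (Real.sqrt (1 - ε) * ·)) ∗ ((gaussianReal 0 1).map (Real.sqrt ε * ·))
      = gaussianReal 0 1 := by
    rw [gaussianReal_map_const_mul, gaussianReal_map_const_mul, gaussianReal_conv_gaussianReal]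
    congr 1
    · simp
    · ext; simp [Real.sq_sqrt hε.1.le, Real.sq_sqrt (sub_nonneg.2 hε.2.le)]
  rw [smLaw]
  conv_rhs => rw [← h1]
  rw [Measure.conv, Measure.map_prod_map _ _ (by fun_prop) (by fun_prop),
    Measure.map_map (by fun_prop) (by fun_prop)]
  rfl

lemma smPdf_gauss (ε : ℝ) (hε : ε ∈ Set.Ioo (0:ℝ) 1) :
    ∀ᵐ x, smPdf ε (gaussianReal 0 1) x = gaussianPDFReal 0 1 x := by
  have h1 := smLaw_eq ε hε (gaussianReal 0 1)
  rw [smLaw_gauss ε hε] at h1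
  have h : volume.withDensity (gaussianPDF 0 1) =
      volume.withDensity (fun x => ENNReal.ofReal (smPdf ε (gaussianReal 0 1) x)) := by
    rw [← gaussianReal_of_var_ne_zero 0 one_ne_zero]; exact h1
  rw [withDensity_eq_iff_of_sigmaFinite] at h
  · filter_upwards [h] with x hx
    have hnn : 0 ≤ smPdf ε (gaussianReal 0 1) x := by
      unfold smPdf
      exact integral_nonneg fun z => gaussianPDFReal_nonneg _ _ _
    rw [← toReal_gaussianPDF, hx, ENNReal.toReal_ofReal hnn]
  · exact (measurable_gaussianPDF 0 1).aemeasurable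
  · exact ((smPdf_meas ε (gaussianReal 0 1)).ennreal_ofReal).aemeasurable

lemma gauss_sq : ∫ x, x ^ 2 ∂(gaussianReal 0 1) = 1 := by
  have h := variance_fun_id_gaussianReal (μ := 0) (v := 1)
  rw [variance_eq_integral (by fun_prop)] at h
  simpa using h

lemma smLaw_sq (ε : ℝ) (hε : ε ∈ Set.Ioo (0:ℝ) 1) (κ : Measure ℝ) [IsProbabilityMeasure κ]
    (hκ : Integrable (fun z => z ^ 2) κ) :
    Integrable (fun x => 1 + x ^ 2) (smLaw ε κ) ∧
    ∫ x, (1 + x ^ 2) ∂(smLaw ε κ) = 1 + ((1 - ε) * ∫ z, z ^ 2 ∂κ) + ε := by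
  set γ := gaussianReal 0 1
  have hg2 : Integrable (fun x : ℝ => x ^ 2) γ := by
    simpa using (memLp_id_gaussianReal (μ := 0) (v := 1) 2).integrable_sq
  have hg1 : Integrable (fun x : ℝ => x) γ := by
    exact (memLp_id_gaussianReal (μ := 0) (v := 1) 1).integrable le_rfl
  have hk1 : Integrable (fun x : ℝ => x) κ := by
    have : MemLp (fun x : ℝ => x) 2 κ := (memLp_two_iff_integrable_sq (by fun_prop)).2 hκ
    exact this.integrable (by norm_num)
  have i1 : Integrable (fun p : ℝ × ℝ => (1 - ε) * p.1 ^ 2) (κ.prod γ) := (hκ.comp_fst γ).const_mul _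
  have i2 : Integrable (fun p : ℝ × ℝ => ε * p.2 ^ 2) (κ.prod γ) := (hg2.comp_snd κ).const_mul _
  have i3 : Integrable (fun p : ℝ × ℝ => 2 * Real.sqrt (1 - ε) * Real.sqrt ε * (p.1 * p.2)) (κ.prod γ) :=
    (hk1.mul_prod hg1).const_mul _
  have heq : (fun p : ℝ × ℝ => 1 + (Real.sqrt (1 - ε) * p.1 + Real.sqrt ε * p.2) ^ 2) =
      fun p => ((1 + (1 - ε) * p.1 ^ 2) + ε * p.2 ^ 2) +
        2 * Real.sqrt (1 - ε) * Real.sqrt ε * (p.1 * p.2) := by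
    ext p
    have e1 := Real.sq_sqrt hε.1.le
    have e2 := Real.sq_sqrt (sub_nonneg.2 hε.2.le)
    calc _ = 1 + (Real.sqrt (1 - ε)) ^ 2 * p.1 ^ 2 + (Real.sqrt ε) ^ 2 * p.2 ^ 2 +
        2 * Real.sqrt (1 - ε) * Real.sqrt ε * (p.1 * p.2) := by ring
      _ = _ := by rw [e1, e2]
  have i4 : Integrable (fun p : ℝ × ℝ => (1:ℝ) + (1 - ε) * p.1 ^ 2) (κ.prod γ) :=
    (integrable_const _).add i1
  have i5 : Integrable (fun p : ℝ × ℝ => (1 + (1 - ε) * p.1 ^ 2) + ε * p.2 ^ 2) (κ.prod γ) := i4.add i2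
  constructor
  · rw [smLaw, integrable_map_measure (by fun_prop) (by fun_prop)]
    change Integrable (fun p : ℝ × ℝ => 1 + (Real.sqrt (1 - ε) * p.1 + Real.sqrt ε * p.2) ^ 2) _
    rw [heq]
    exact i5.add i3
  · rw [smLaw, integral_map (by fun_prop) (by fun_prop)]
    change ∫ p : ℝ × ℝ, 1 + (Real.sqrt (1 - ε) * p.1 + Real.sqrt ε * p.2) ^ 2 ∂(κ.prod γ) = _
    rw [heq, integral_add i5 i3, integral_add i4 i2, integral_add (integrable_const _) i1,
      integral_const_mul, integral_const_mul, integral_const_mul, integral_prod_mul (fun x : ℝ => x) (fun x : ℝ => x),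
      integral_fun_fst (fun x : ℝ => x ^ 2), integral_fun_snd (fun x : ℝ => x ^ 2)]
    have : ∫ x, x ∂γ = 0 := integral_id_gaussianReal
    rw [this, gauss_sq]
    simp

lemma smooth_kl (ε : ℝ) (hε : ε ∈ Set.Ioo (0:ℝ) 1) (κ : ℕ → Measure ℝ)
    (hκp : ∀ n, IsProbabilityMeasure (κ n)) (hκi : ∀ n, Integrable (fun z => z ^ 2) (κ n))
    (hκl : Tendsto (fun n => ∫ z, z ^ 2 ∂(κ n)) atTop (nhds 1))
    (hw : ∀ g : BoundedContinuousFunction ℝ ℝ, Tendsto (fun n => ∫ z, g z ∂(κ n)) atTop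
      (nhds (∫ z, g z ∂(gaussianReal 0 1)))) :
    Tendsto (fun n => klDiv (smLaw ε (κ n)) (gaussianReal 0 1)) atTop (nhds (0 : EReal)) := by
  have hv : ε.toNNReal ≠ 0 := by simp [hε.1]
  have hvc : (ε.toNNReal : ℝ) = ε := Real.coe_toNNReal _ hε.1.le
  have hε1 := hε.1
  simp_rw [fun n => smLaw_eq ε hε (κ n)]
  have hitg : ∀ (κ : Measure ℝ) [IsProbabilityMeasure κ], Integrable (fun z => z ^ 2) κ →
      Integrable (fun x => (1 + x ^ 2) * smPdf ε κ x) ∧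
      ∫ x, (1 + x ^ 2) * smPdf ε κ x = 1 + ((1 - ε) * ∫ z, z ^ 2 ∂κ) + ε := by
    intro κ _ hκ
    have hm := smPdf_meas ε κ
    have hnn : ∀ x, 0 ≤ smPdf ε κ x := fun x => integral_nonneg fun z => gaussianPDFReal_nonneg _ _ _
    obtain ⟨h1, h2⟩ := smLaw_sq ε hε κ hκ
    rw [smLaw_eq ε hε κ] at h1 h2
    rw [integrable_withDensity_iff_integrable_smul' (by fun_prop)
      (ae_of_all _ fun x => ENNReal.ofReal_lt_top)] at h1
    rw [integral_withDensity_eq_integral_toReal_smul (by fun_prop)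
      (ae_of_all _ fun x => ENNReal.ofReal_lt_top)] at h2
    have he : (fun x => (ENNReal.ofReal (smPdf ε κ x)).toReal • (1 + x ^ 2)) =
       fun x => (1 + x ^ 2) * smPdf ε κ x := by
      ext x; rw [ENNReal.toReal_ofReal (hnn x), smul_eq_mul, mul_comm]
    rw [he] at h1 h2
    exact ⟨h1, h2⟩
  have hγ2 : Integrable (fun x : ℝ => x ^ 2) (gaussianReal 0 1) := by
    simpa using (memLp_id_gaussianReal (μ := 0) (v := 1) 2).integrable_sq
  have hpos : ∀ n x, 0 < smPdf ε (κ n) x := by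
    intro n x
    rw [smPdf, integral_pos_iff_support_of_nonneg (fun z => gaussianPDFReal_nonneg _ _ _)
      (gpdf_int ε (κ n) x)]
    have : Function.support (fun z => gaussianPDFReal (Real.sqrt (1 - ε) * z) ε.toNNReal x) = Set.univ := by
      ext z; simpa using (gaussianPDFReal_pos _ _ _ hv).ne'
    rw [this]; simp
  have hlow : ∀ᶠ n in atTop, ∀ x, (1/2) * ((Real.sqrt (2 * π * ε))⁻¹ * Real.exp (-(|x| + 2) ^ 2 / (2 * ε)))
      ≤ smPdf ε (κ n) x := by
    filter_upwards [hκl.eventually (gt_mem_nhds (show (1:ℝ) < 2 by norm_num))] with n hn x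
    have hr : Real.sqrt (1 - ε) ≤ 1 := by
      rw [Real.sqrt_le_left (by norm_num)]; linarith
    set L := (Real.sqrt (2 * π * ε))⁻¹ * Real.exp (-(|x| + 2) ^ 2 / (2 * ε)) with hL
    have hLp : 0 ≤ L := by positivity
    have hpt : ∀ z : ℝ, L * (1 - z ^ 2 / 4) ≤ gaussianPDFReal (Real.sqrt (1 - ε) * z) ε.toNNReal x := by
      intro z
      by_cases hz : |z| ≤ 2
      · refine (mul_le_of_le_one_right hLp (by nlinarith [sq_nonneg z])).trans ?_
        rw [gaussianPDFReal, hvc, hL]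
        refine mul_le_mul_of_nonneg_left (Real.exp_le_exp.2 ?_) (by positivity)
        refine div_le_div_of_nonneg_right (neg_le_neg ?_) (by positivity)
        have h3 : |Real.sqrt (1 - ε) * z| ≤ 2 := by
          rw [abs_mul, abs_of_nonneg (Real.sqrt_nonneg _)]
          nlinarith [abs_nonneg z, Real.sqrt_nonneg (1 - ε)]
        have h4 : |x - Real.sqrt (1 - ε) * z| ≤ |x| + 2 := (abs_sub _ _).trans (by linarith)
        exact sq_le_sq' (by linarith [(abs_le.1 h4).1]) (abs_le.1 h4).2
      · push Not at hz
        refine le_trans ?_ (gaussianPDFReal_nonneg _ _ _)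
        refine mul_nonpos_of_nonneg_of_nonpos hLp ?_
        have := sq_abs z
        nlinarith
    have hmono := integral_mono (μ := κ n) (f := fun z => L * (1 - z ^ 2 / 4))
      (((integrable_const (1:ℝ)).sub ((hκi n).div_const 4)).const_mul L)
      (gpdf_int ε (κ n) x) hpt
    refine le_trans ?_ hmono
    have : ∫ z, L * (1 - z ^ 2 / 4) ∂(κ n) = L * (1 - (∫ z, z ^ 2 ∂(κ n)) / 4) := by
      rw [integral_const_mul]
      rw [integral_sub (integrable_const _) ((hκi n).div_const 4), integral_div]
      simp
    rw [this]
    nlinarith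
  refine kl_tendsto (fun n => smPdf ε (κ n)) (fun n => smPdf_meas ε (κ n)) hpos
    ((Real.sqrt (2 * π * ε))⁻¹) ?_ (|Real.log ((1/2) * (Real.sqrt (2 * π * ε))⁻¹)| + 4 / ε) ?_
    (fun n => (hitg (κ n) (hκi n)).1) ?_ ?_
  · intro n x
    have := integral_mono (μ := κ n) (gpdf_int ε (κ n) x) (integrable_const ((Real.sqrt (2 * π * ε))⁻¹))
      (fun z => by have := gpdf_le (Real.sqrt (1 - ε) * z) ε.toNNReal x; rwa [hvc] at this)
    simpa [smPdf] using this
  · filter_upwards [hlow] with n hn x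
    refine le_trans ?_ (Real.log_le_log (by positivity) (hn x))
    rw [← mul_assoc, Real.log_mul (by positivity) (Real.exp_pos _).ne', Real.log_exp]
    have h1 := neg_abs_le (Real.log ((1/2) * (Real.sqrt (2 * π * ε))⁻¹))
    have h2 : (|x| + 2) ^ 2 / (2 * ε) ≤ 4 / ε * (1 + x ^ 2) := by
      rw [div_mul_eq_mul_div, div_le_div_iff₀ (by positivity) hε1]
      have := sq_abs x
      nlinarith [sq_nonneg (|x| - 2), mul_nonneg hε1.le (sq_nonneg (|x| - 2)),
        mul_nonneg hε1.le (sq_nonneg (|x|))]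
    have h3 := mul_nonneg (abs_nonneg (Real.log ((1/2) * (Real.sqrt (2 * π * ε))⁻¹))) (sq_nonneg x)
    rw [neg_div]
    nlinarith
  · filter_upwards [smPdf_gauss ε hε] with x hx
    rw [← hx]
    let g : BoundedContinuousFunction ℝ ℝ := BoundedContinuousFunction.ofNormedAddCommGroup
      (fun z => gaussianPDFReal (Real.sqrt (1 - ε) * z) ε.toNNReal x)
      (by unfold gaussianPDFReal; fun_prop) ((Real.sqrt (2 * π * ε))⁻¹)
      (fun z => by
        have := gpdf_le (Real.sqrt (1 - ε) * z) ε.toNNReal x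
        rw [hvc] at this
        rwa [Real.norm_eq_abs, abs_of_nonneg (gaussianPDFReal_nonneg _ _ _)])
    exact hw g
  · have h1 : ∫ x, (1 + x ^ 2) * gaussianPDFReal 0 1 x = 1 + ((1 - ε) * 1) + ε := by
      have h0 := (hitg (gaussianReal 0 1) hγ2).2
      rw [gauss_sq] at h0
      rw [← h0]
      refine integral_congr_ae ?_
      filter_upwards [smPdf_gauss ε hε] with x hx
      rw [hx]
    rw [h1]
    simp_rw [fun n => (hitg (κ n) (hκi n)).2]
    exact ((hκl.const_mul _).const_add _).add_const _


lemma iid_sq {Ω : Type*} [MeasurableSpace Ω] (P : Measure Ω) [IsProbabilityMeasure P]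
    (U : ℕ → Ω → ℝ) (hU : iIndepFun U P) (hL : ∀ i, MemLp (U i) 2 P)
    (h0 : ∀ i, ∫ ω, U i ω ∂P = 0) (σ : ℝ) (h1 : ∀ i, ∫ ω, (U i ω) ^ 2 ∂P = σ) (n : ℕ) :
    ∫ ω, (∑ i ∈ Finset.range n, U i ω) ^ 2 ∂P = n * σ := by
  have hv := IndepFun.variance_sum (μ := P) (X := U) (s := Finset.range n) (fun i _ => hL i)
    (fun i _ j _ hij => hU.indepFun hij)
  have e1 : ∀ i, Var[U i; P] = σ := by
    intro i
    rw [variance_of_integral_eq_zero (hL i).aestronglyMeasurable.aemeasurable (h0 i)]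
    exact h1 i
  rw [Finset.sum_congr rfl (fun i _ => e1 i)] at hv
  rw [variance_of_integral_eq_zero] at hv
  · simp only [Finset.sum_apply] at hv
    rw [hv]; simp
  · exact (Finset.aemeasurable_sum _ (fun i _ => (hL i).aestronglyMeasurable.aemeasurable))
  · simp only [Finset.sum_apply]
    rw [integral_finsetSum _ (fun i _ => (hL i).integrable (by norm_num))]
    simp [h0]

lemma clt_part {Ω : Type*} [MeasurableSpace Ω] (P : Measure Ω) [IsProbabilityMeasure P]
    (U : ℕ → Ω → ℝ) (hU : iIndepFun U P) (hL : ∀ i, MemLp (U i) 2 P)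
    (h0 : ∀ i, ∫ ω, U i ω ∂P = 0) (h1 : ∀ i, ∫ ω, (U i ω) ^ 2 ∂P = 1)
    (hid : ∀ i, IdentDistrib (U i) (U 0) P P)
    (Z : ℕ → Ω → ℝ) (hZ : ∀ n, Measurable (Z n)) (hZL : ∀ n, MemLp (Z n) 2 P)
    (hD : Tendsto (fun n : ℕ => ∫ ω, (Z n ω - (√(n:ℝ))⁻¹ * ∑ i ∈ Finset.range n, U i ω) ^ 2 ∂P)
      atTop (nhds 0)) :
    Tendsto (fun n => ∫ ω, (Z n ω) ^ 2 ∂P) atTop (nhds 1) ∧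
    ∀ g : BoundedContinuousFunction ℝ ℝ, Tendsto (fun n => ∫ z, g z ∂(Measure.map (Z n) P)) atTop
      (nhds (∫ z, g z ∂gaussianReal 0 1)) := by
  set W : ℕ → Ω → ℝ := fun n ω => (√(n:ℝ))⁻¹ * ∑ i ∈ Finset.range n, U i ω with hW
  have hWL : ∀ n, MemLp (W n) 2 P := by
    intro n
    have := (memLp_finsetSum (Finset.range n) (fun i _ => hL i)).const_mul ((√(n:ℝ))⁻¹)
    simpa [hW] using this
  have hDL : ∀ n, MemLp (fun ω => Z n ω - W n ω) 2 P := fun n => (hZL n).sub (hWL n)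
  have hWsq : ∀ n : ℕ, 1 ≤ n → ∫ ω, (W n ω) ^ 2 ∂P = 1 := by
    intro n hn
    have hn' : (0:ℝ) < n := by exact_mod_cast hn
    simp only [hW, mul_pow]
    rw [integral_const_mul, iid_sq P U hU hL h0 1 h1 n, inv_pow, Real.sq_sqrt hn'.le]
    field_simp
  constructor
  · rw [Metric.tendsto_atTop]
    intro r hr
    set η := min (r/4) 1 with hη
    have hη0 : 0 < η := by positivity
    have hηr : η ≤ r/4 := min_le_left _ _
    have := (hD.const_mul (1 + η⁻¹))
    rw [mul_zero, Metric.tendsto_atTop] at this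
    obtain ⟨N, hN⟩ := this (r/4) (by positivity)
    refine ⟨max N 1, fun n hn => ?_⟩
    have hn1 : 1 ≤ n := le_trans (le_max_right _ _) hn
    have hnN := hN n (le_trans (le_max_left _ _) hn)
    rw [Real.dist_eq, sub_zero] at hnN
    have hnN := lt_of_le_of_lt (le_abs_self _) hnN
    have iZ := (hZL n).integrable_sq
    have iW := (hWL n).integrable_sq
    have iD := (hDL n).integrable_sq
    have key : ∀ ω, |(Z n ω) ^ 2 - (W n ω) ^ 2| ≤ η * (W n ω) ^ 2
        + (1 + η⁻¹) * (Z n ω - W n ω) ^ 2 := by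
      intro ω
      set d := Z n ω - W n ω with hd
      have e : Z n ω = W n ω + d := by rw [hd]; ring
      rw [e]
      have hinv : η * η⁻¹ = 1 := mul_inv_cancel₀ hη0.ne'
      have q1 : 0 ≤ η * (W n ω - η⁻¹ * d) ^ 2 := by positivity
      have q2 : 0 ≤ η * (W n ω + η⁻¹ * d) ^ 2 := by positivity
      have q1' : η * (W n ω - η⁻¹ * d) ^ 2 = η * W n ω ^ 2 - 2 * (η * η⁻¹) * W n ω * d
        + (η * η⁻¹) * η⁻¹ * d ^ 2 := by ring
      have q2' : η * (W n ω + η⁻¹ * d) ^ 2 = η * W n ω ^ 2 + 2 * (η * η⁻¹) * W n ω * d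
        + (η * η⁻¹) * η⁻¹ * d ^ 2 := by ring
      rw [hinv] at q1' q2'
      rw [abs_le]
      constructor <;> nlinarith [sq_nonneg d]
    rw [Real.dist_eq, ← hWsq n hn1, ← integral_sub iZ iW]
    calc |∫ ω, (Z n ω ^ 2 - W n ω ^ 2) ∂P| ≤ ∫ ω, |Z n ω ^ 2 - W n ω ^ 2| ∂P :=
          abs_integral_le_integral_abs
      _ ≤ ∫ ω, (η * (W n ω) ^ 2 + (1 + η⁻¹) * (Z n ω - W n ω) ^ 2) ∂P :=
          integral_mono (iZ.sub iW).abs ((iW.const_mul _).add (iD.const_mul _)) key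
      _ = η * 1 + (1 + η⁻¹) * ∫ ω, (Z n ω - W n ω) ^ 2 ∂P := by
          rw [integral_add (iW.const_mul _) (iD.const_mul _), integral_const_mul,
            integral_const_mul, hWsq n hn1]
      _ < r := by linarith
  · have hlaw : HasLaw (id : ℝ → ℝ) (gaussianReal 0 1) (gaussianReal 0 1) := HasLaw.id
    have hclt := tendstoInDistribution_inv_sqrt_mul_sum hlaw (h0 0) (h1 0) hU hid
    have hm : TendstoInMeasure P (Z - W) atTop 0 := by
      refine tendstoInMeasure_of_tendsto_eLpNorm (p := 2) (by norm_num)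
        (fun n => (hDL n).aestronglyMeasurable) aestronglyMeasurable_const ?_
      have e : ∀ n, eLpNorm ((Z - W) n - 0) 2 P
          = ENNReal.ofReal ((∫ ω, (Z n ω - W n ω) ^ 2 ∂P) ^ (2:ℝ)⁻¹) := by
        intro n
        have := (hDL n).eLpNorm_eq_integral_rpow_norm (by norm_num) (by norm_num)
        rw [sub_zero]
        change eLpNorm (fun ω => Z n ω - W n ω) 2 P = _
        rw [this]
        congr 2
        · refine integral_congr_ae (ae_of_all _ fun ω => ?_)
          simp
      simp only [e]
      have := (hD.rpow_const (p := (2:ℝ)⁻¹) (Or.inr (by norm_num)))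
      rw [Real.zero_rpow (by norm_num)] at this
      have q := (ENNReal.continuous_ofReal.tendsto _).comp this
      rw [ENNReal.ofReal_zero] at q
      exact q
    have := tendstoInDistribution_of_tendstoInMeasure_sub Z id hclt hm
      (fun n => (hZ n).aemeasurable)
    have h := ProbabilityMeasure.tendsto_iff_forall_integral_tendsto.1 this.tendsto
    intro g
    have := h g
    simpa using this

lemma assembly {Ω : Type*} [MeasurableSpace Ω] (P : Measure Ω) [IsProbabilityMeasure P]
    (U : ℕ → Ω → ℝ) (hU : iIndepFun U P) (hL : ∀ i, MemLp (U i) 2 P)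
    (h0 : ∀ i, ∫ ω, U i ω ∂P = 0) (h1 : ∀ i, ∫ ω, (U i ω) ^ 2 ∂P = 1)
    (hid : ∀ i, IdentDistrib (U i) (U 0) P P)
    (Z : ℕ → Ω → ℝ) (hZ : ∀ n, Measurable (Z n)) (hZL : ∀ n, MemLp (Z n) 2 P)
    (hD : Tendsto (fun n : ℕ => ∫ ω, (Z n ω - (√(n:ℝ))⁻¹ * ∑ i ∈ Finset.range n, U i ω) ^ 2 ∂P)
      atTop (nhds 0))
    (G : Ω → ℝ) (hG_meas : Measurable G)
    (hG_law : Measure.map G P = gaussianReal 0 1)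
    (hG_indep : ∀ n : ℕ, IndepFun G (Z n) P)
    (ε : ℝ) (hε : ε ∈ Set.Ioo (0 : ℝ) 1)
    (Ztil : ℕ → Ω → ℝ)
    (hZtil : ∀ (n : ℕ) (ω : Ω),
      Ztil n ω = Real.sqrt (1 - ε) * Z n ω + Real.sqrt ε * G ω) :
    Tendsto (fun n => klDiv (Measure.map (Ztil n) P) (gaussianReal 0 1)) atTop
      (nhds (0 : EReal)) := by
  obtain ⟨c1, c2⟩ := clt_part P U hU hL h0 h1 hid Z hZ hZL hD
  have e : ∀ n, Measure.map (Ztil n) P = smLaw ε (Measure.map (Z n) P) := by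
    intro n
    have hi := (indepFun_iff_map_prod_eq_prod_map_map (hZ n).aemeasurable
      hG_meas.aemeasurable).1 (hG_indep n).symm
    rw [smLaw, ← hG_law, ← hi, Measure.map_map (by fun_prop) ((hZ n).prodMk hG_meas)]
    congr 1
    funext ω
    simp [hZtil]
  simp only [e]
  refine smooth_kl ε hε _ (fun n => Measure.isProbabilityMeasure_map (hZ n).aemeasurable) ?_ ?_ c2
  · intro n
    rw [integrable_map_measure (by fun_prop) (hZ n).aemeasurable]
    exact (hZL n).integrable_sq
  · convert c1 using 2 with n
    rw [integral_map (hZ n).aemeasurable (by fun_prop)]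

def ExpSmall (u : ℕ → ENNReal) : Prop :=
  ∃ C ρ : ℝ, 0 ≤ C ∧ 0 ≤ ρ ∧ ρ < 1 ∧ ∀ n : ℕ, 1 ≤ n → u n ≤ ENNReal.ofReal (C * ρ ^ n)

lemma ExpSmall.mono {u v : ℕ → ENNReal} (hv : ExpSmall v) (h : ∀ n, 1 ≤ n → u n ≤ v n) :
    ExpSmall u := by
  obtain ⟨C, ρ, h1, h2, h3, h4⟩ := hv
  exact ⟨C, ρ, h1, h2, h3, fun n hn => (h n hn).trans (h4 n hn)⟩

lemma ExpSmall.add {u v : ℕ → ENNReal} (hu : ExpSmall u) (hv : ExpSmall v) :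
    ExpSmall (fun n => u n + v n) := by
  obtain ⟨C, ρ, h1, h2, h3, h4⟩ := hu
  obtain ⟨C', ρ', h1', h2', h3', h4'⟩ := hv
  refine ⟨C + C', max ρ ρ', by positivity, le_max_of_le_left h2, max_lt h3 h3', fun n hn => ?_⟩
  refine (add_le_add (h4 n hn) (h4' n hn)).trans ?_
  rw [← ENNReal.ofReal_add (by positivity) (by positivity), add_mul]
  refine ENNReal.ofReal_le_ofReal ?_
  gcongr
  · exact le_max_left _ _
  · exact le_max_right _ _

lemma ExpSmall.zero : ExpSmall (fun _ => 0) := ⟨0, 0, le_rfl, le_rfl, one_pos, fun _ _ => by simp⟩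

lemma l2_pt (I b κ n S h Q : ℝ) (hI : 0 < I) (hκ : 0 < κ) (hκI : κ ≤ I / 2) (hn : 0 < n)
    (hb : |h| ≤ b) (hQ : S ^ 4 ≤ Q) (t : ℝ) (ht0 : 0 ≤ t)
    (ht : κ * |h| < |I * h - S| → t = 1) :
    n / I * (I * h - S) ^ 2 ≤ 4 * κ ^ 2 / I ^ 3 * (n * S ^ 2)
      + 2 / I * ((n * (I ^ 2 * b ^ 2) + n ^ 3) * t + n⁻¹ * Q) := by
  have hQ0 : 0 ≤ Q := le_trans (by positivity) hQ
  have hb2 : h ^ 2 ≤ b ^ 2 := by rw [← sq_abs]; gcongr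
  by_cases hc : κ * |h| < |I * h - S|
  · rw [ht hc, mul_one]
    have a1 : (I * h - S) ^ 2 ≤ 2 * (I ^ 2 * b ^ 2 + S ^ 2) := by
      nlinarith [sq_nonneg (I * h + S), mul_le_mul_of_nonneg_left hb2 (sq_nonneg I)]
    have a2 : n * S ^ 2 ≤ n ^ 3 + n⁻¹ * Q := by
      have : n * S ^ 2 ≤ n ^ 3 + n⁻¹ * S ^ 4 := by
        have e : n⁻¹ * (n ^ 2 - S ^ 2) ^ 2 = n ^ 3 - 2 * (n * S ^ 2) + n⁻¹ * S ^ 4 := by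
          field_simp
          ring
        have : 0 ≤ n⁻¹ * (n ^ 2 - S ^ 2) ^ 2 := by positivity
        have : 0 ≤ n * S ^ 2 := by positivity
        linarith
      have := mul_le_mul_of_nonneg_left hQ (inv_nonneg.2 hn.le)
      linarith
    calc n / I * (I * h - S) ^ 2 ≤ n / I * (2 * (I ^ 2 * b ^ 2 + S ^ 2)) := by gcongr
      _ = 2 / I * (n * (I ^ 2 * b ^ 2) + n * S ^ 2) := by ring
      _ ≤ 2 / I * (n * (I ^ 2 * b ^ 2) + n ^ 3 + n⁻¹ * Q) := by
          refine mul_le_mul_of_nonneg_left ?_ (by positivity)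
          linarith
      _ ≤ _ := by
          have : 0 ≤ 4 * κ ^ 2 / I ^ 3 * (n * S ^ 2) := by positivity
          linarith
  · push Not at hc
    have h1 : I * |h| ≤ 2 * |S| := by
      have : |I * h| ≤ |I * h - S| + |S| := by
        have := abs_add_le (I * h - S) S
        simpa using this
      rw [abs_mul, abs_of_pos hI] at this
      have : κ * |h| ≤ I / 2 * |h| := by gcongr
      nlinarith
    have h2 : |h| ≤ 2 * |S| / I := by rw [le_div_iff₀ hI]; linarith
    have h3 : (I * h - S) ^ 2 ≤ (κ * (2 * |S| / I)) ^ 2 := by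
      rw [← sq_abs]
      have := hc.trans (mul_le_mul_of_nonneg_left h2 hκ.le)
      gcongr
    have : 0 ≤ 2 / I * ((n * (I ^ 2 * b ^ 2) + n ^ 3) * t + n⁻¹ * Q) := by positivity
    calc n / I * (I * h - S) ^ 2 ≤ n / I * (κ * (2 * |S| / I)) ^ 2 := by gcongr
      _ = 4 * κ ^ 2 / I ^ 3 * (n * |S| ^ 2) := by field_simp; ring
      _ ≤ _ := by rw [sq_abs]; linarith

lemma l2_close {Ω : Type*} [MeasurableSpace Ω] (P : Measure Ω) [IsProbabilityMeasure P]
    (U : ℕ → Ω → ℝ) (hUm : ∀ i, Measurable (U i)) (hU : iIndepFun U P) (hL : ∀ i, MemLp (U i) 2 P)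
    (I : ℝ) (hI : 0 < I) (M : ℝ)
    (h0 : ∀ i, ∫ ω, U i ω ∂P = 0) (h1 : ∀ i, ∫ ω, (U i ω) ^ 2 ∂P = I)
    (h4i : ∀ i, Integrable (fun ω => (U i ω) ^ 4) P) (h4 : ∀ i, ∫ ω, (U i ω) ^ 4 ∂P = M)
    (h : ℕ → Ω → ℝ) (hh : ∀ n, Measurable (h n)) (b : ℝ) (hb : ∀ n ω, |h n ω| ≤ b)
    (hbad : ∀ κ : ℝ, 0 < κ → ExpSmall (fun n => P {ω | κ * |h n ω| <
      |I * h n ω - (n:ℝ)⁻¹ * ∑ i ∈ Finset.range n, U i ω|})) :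
    Tendsto (fun n : ℕ => ∫ ω, (√(I * n) * h n ω
      - (√(n:ℝ))⁻¹ * ∑ i ∈ Finset.range n, (√I)⁻¹ * U i ω) ^ 2 ∂P) atTop (nhds 0) := by
  have hbound : ∀ κ : ℝ, 0 < κ → κ ≤ I / 2 → ∃ C ρ : ℝ, 0 ≤ ρ ∧ ρ < 1 ∧ ∀ n : ℕ, 1 ≤ n →
      ∫ ω, (√(I * n) * h n ω
      - (√(n:ℝ))⁻¹ * ∑ i ∈ Finset.range n, (√I)⁻¹ * U i ω) ^ 2 ∂P ≤
      4 * κ ^ 2 / I ^ 3 * I + 2 / I * ((n * (I ^ 2 * b ^ 2) + n ^ 3) * (C * ρ ^ n) + (n:ℝ)⁻¹ * M) := by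
    intro κ hκ hκI
    obtain ⟨C, ρ, hC, hρ0, hρ1, hP⟩ := hbad κ hκ
    refine ⟨C, ρ, hρ0, hρ1, fun n hn => ?_⟩
    have hn' : (0:ℝ) < n := by exact_mod_cast hn
    set S : Ω → ℝ := fun ω => (n:ℝ)⁻¹ * ∑ i ∈ Finset.range n, U i ω with hS
    have hSm : Measurable S := by
      refine Measurable.const_mul ?_ _
      exact Finset.measurable_sum _ (fun i _ => hUm i)
    set bad : Set Ω := {ω | κ * |h n ω| < |I * h n ω - S ω|} with hbaddef
    have hbm : MeasurableSet bad := by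
      have := hh n
      exact measurableSet_lt (by fun_prop) (by fun_prop)
    set Q : Ω → ℝ := fun ω => (n:ℝ)⁻¹ * ∑ i ∈ Finset.range n, (U i ω) ^ 4 with hQ
    have hQi : Integrable Q P := (integrable_finsetSum _ (fun i _ => h4i i)).const_mul _
    have hSL : MemLp S 2 P := (memLp_finsetSum (Finset.range n) (fun i _ => hL i)).const_mul _
    have hSQ : ∀ ω, S ω ^ 4 ≤ Q ω := by
      intro ω
      have a1 := sq_sum_le_card_mul_sum_sq (s := Finset.range n) (f := fun i => U i ω)
      have a2 := sq_sum_le_card_mul_sum_sq (s := Finset.range n) (f := fun i => U i ω ^ 2)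
      simp only [Finset.card_range, ← pow_mul] at a1 a2
      norm_num at a2
      have a3 : (∑ i ∈ Finset.range n, U i ω) ^ 4 ≤ n ^ 3 * ∑ i ∈ Finset.range n, U i ω ^ 4 := by
        calc (∑ i ∈ Finset.range n, U i ω) ^ 4 = ((∑ i ∈ Finset.range n, U i ω) ^ 2) ^ 2 := by ring
          _ ≤ (n * ∑ i ∈ Finset.range n, U i ω ^ 2) ^ 2 := by gcongr
          _ = n ^ 2 * (∑ i ∈ Finset.range n, U i ω ^ 2) ^ 2 := by ring
          _ ≤ n ^ 2 * (n * ∑ i ∈ Finset.range n, U i ω ^ 4) := by gcongr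
          _ = _ := by ring
      simp only [hS, hQ, mul_pow]
      calc (n:ℝ)⁻¹ ^ 4 * (∑ i ∈ Finset.range n, U i ω) ^ 4
          ≤ (n:ℝ)⁻¹ ^ 4 * (n ^ 3 * ∑ i ∈ Finset.range n, U i ω ^ 4) := by gcongr
        _ = _ := by field_simp
    have hbreal : P.real bad ≤ C * ρ ^ n := by
      rw [Measure.real]
      exact ENNReal.toReal_le_of_le_ofReal (by positivity) (hP n hn)
    have hpt : ∀ ω, (√(I * n) * h n ω
      - (√(n:ℝ))⁻¹ * ∑ i ∈ Finset.range n, (√I)⁻¹ * U i ω) ^ 2 ≤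
        4 * κ ^ 2 / I ^ 3 * (n * S ω ^ 2)
      + 2 / I * ((n * (I ^ 2 * b ^ 2) + n ^ 3) * (bad.indicator (fun _ => (1:ℝ)) ω) + (n:ℝ)⁻¹ * Q ω) := by
      intro ω
      have e : (√(I * n) * h n ω - (√(n:ℝ))⁻¹ * ∑ i ∈ Finset.range n, (√I)⁻¹ * U i ω) ^ 2
          = n / I * (I * h n ω - S ω) ^ 2 := by
        have q1 : √(I * n) * h n ω - (√(n:ℝ))⁻¹ * ∑ i ∈ Finset.range n, (√I)⁻¹ * U i ω
            = √n * (√I)⁻¹ * (I * h n ω - S ω) := by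
          rw [← Finset.mul_sum, hS, Real.sqrt_mul hI.le]
          have r1 : √I * √I = I := Real.mul_self_sqrt hI.le
          have r2 : √(n:ℝ) * √(n:ℝ) = n := Real.mul_self_sqrt hn'.le
          have r3 : √I ≠ 0 := (Real.sqrt_pos.2 hI).ne'
          have r4 : √(n:ℝ) ≠ 0 := (Real.sqrt_pos.2 hn').ne'
          have r5 : (√I)⁻¹ * I = √I := by field_simp; linarith
          have r6 : √(n:ℝ) * (n:ℝ)⁻¹ = (√(n:ℝ))⁻¹ := by field_simp; linarith
          calc _ = √n * ((√I)⁻¹ * I) * h n ω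
                - (√(n:ℝ) * (n:ℝ)⁻¹) * ((√I)⁻¹ * ∑ i ∈ Finset.range n, U i ω) := by
                rw [r5, r6]; ring
            _ = _ := by ring
        rw [q1, mul_pow, mul_pow, inv_pow, Real.sq_sqrt hn'.le, Real.sq_sqrt hI.le]
        ring
      rw [e]
      refine l2_pt I b κ n (S ω) (h n ω) (Q ω) hI hκ hκI hn' (hb n ω) (hSQ ω) _ ?_ ?_
      · exact Set.indicator_nonneg (fun _ _ => zero_le_one) _
      · intro hc
        exact Set.indicator_of_mem (s := bad) hc _
    have iind : Integrable (bad.indicator (fun _ => (1:ℝ))) P :=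
      (integrable_const _).indicator hbm
    have iS := hSL.integrable_sq
    have eS : ∫ ω, (n * S ω ^ 2) ∂P = I := by
      simp only [hS, mul_pow]
      rw [integral_const_mul, integral_const_mul, iid_sq P U hU hL h0 I h1 n]
      field_simp
    have eQ : ∫ ω, Q ω ∂P = M := by
      simp only [hQ]
      rw [integral_const_mul, integral_finsetSum _ (fun i _ => h4i i)]
      simp only [h4, Finset.sum_const, Finset.card_range, nsmul_eq_mul]
      field_simp
    have eI : ∫ ω, bad.indicator (fun _ => (1:ℝ)) ω ∂P = P.real bad := by
      rw [integral_indicator hbm]; simp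
    have iR : Integrable (fun ω => 2 / I * ((n * (I ^ 2 * b ^ 2) + n ^ 3) *
        (bad.indicator (fun _ => (1:ℝ)) ω) + (n:ℝ)⁻¹ * Q ω)) P :=
      ((iind.const_mul _).add (hQi.const_mul _)).const_mul _
    have iL : Integrable (fun ω => 4 * κ ^ 2 / I ^ 3 * (n * S ω ^ 2)) P :=
      (iS.const_mul _).const_mul _
    refine (integral_mono_of_nonneg (ae_of_all _ fun ω => sq_nonneg _) (iL.add iR)
      (ae_of_all _ hpt)).trans ?_
    refine (le_of_eq (integral_add iL iR)).trans ?_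
    rw [integral_const_mul, eS, integral_const_mul]
    rw [integral_add (iind.const_mul _) (hQi.const_mul _), integral_const_mul, integral_const_mul,
      eQ, eI]
    gcongr
  rw [Metric.tendsto_atTop]
  intro r hr
  obtain ⟨κ, hκ, hκI, hκr⟩ : ∃ κ : ℝ, 0 < κ ∧ κ ≤ I / 2 ∧ 4 * κ ^ 2 / I ^ 3 * I ≤ r / 2 := by
    refine ⟨min (I / 2) (I * √(r / 8)), by positivity, min_le_left _ _, ?_⟩
    calc 4 * (min (I / 2) (I * √(r / 8))) ^ 2 / I ^ 3 * I ≤ 4 * (I * √(r / 8)) ^ 2 / I ^ 3 * I := by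
          gcongr
          exact min_le_right _ _
      _ = r / 2 := by
          rw [mul_pow, Real.sq_sqrt (by positivity)]
          field_simp
          norm_num
  obtain ⟨C, ρ, hρ0, hρ1, hb2⟩ := hbound κ hκ hκI
  have t1 := tendsto_pow_const_mul_const_pow_of_lt_one 1 hρ0 hρ1
  have t3 := tendsto_pow_const_mul_const_pow_of_lt_one 3 hρ0 hρ1
  have tM : Tendsto (fun n : ℕ => (n:ℝ)⁻¹ * M) atTop (nhds 0) := by
    simpa using (tendsto_inv_atTop_nhds_zero_nat (𝕜 := ℝ)).mul_const M
  have tt : Tendsto (fun n : ℕ => 2 / I * ((n * (I ^ 2 * b ^ 2) + n ^ 3) * (C * ρ ^ n)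
      + (n:ℝ)⁻¹ * M)) atTop (nhds 0) := by
    have := ((((t1.const_mul (I ^ 2 * b ^ 2 * C)).add (t3.const_mul C))).add tM).const_mul (2 / I)
    simp only [mul_zero, add_zero] at this
    refine this.congr (fun n => ?_)
    ring
  rw [Metric.tendsto_atTop] at tt
  obtain ⟨N, hN⟩ := tt (r / 2) (by positivity)
  refine ⟨max N 1, fun n hn => ?_⟩
  have hn1 : 1 ≤ n := le_trans (le_max_right _ _) hn
  have hnN := hN n (le_trans (le_max_left _ _) hn)
  rw [Real.dist_eq, sub_zero] at hnN ⊢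
  have hnN := lt_of_le_of_lt (le_abs_self _) hnN
  rw [abs_of_nonneg (integral_nonneg fun ω => sq_nonneg _)]
  have := hb2 n hn1
  linarith

lemma ExpSmall.of_chernoff {u : ℕ → ENNReal} (h : ∃ ρ : ℝ, 0 ≤ ρ ∧ ρ < 1 ∧ ∀ n : ℕ,
    u n ≤ ENNReal.ofReal (ρ ^ n)) : ExpSmall u := by
  obtain ⟨ρ, h1, h2, h3⟩ := h
  exact ⟨1, ρ, zero_le_one, h1, h2, fun n _ => by simpa using h3 n⟩

lemma consist {Ω 𝓧 : Type*} [MeasurableSpace Ω] [MeasurableSpace 𝓧] (P : Measure Ω)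
    [IsProbabilityMeasure P] (ν : Measure 𝓧) [IsProbabilityMeasure ν] (X : ℕ → Ω → 𝓧)
    (hXm : ∀ i, Measurable (X i)) (hXi : iIndepFun X P) (hXl : ∀ i, Measure.map (X i) P = ν)
    (K : Set ℝ) (hK : IsCompact K) (θ₀ : ℝ) (hθ₀ : θ₀ ∈ K) (L : ℝ → 𝓧 → ℝ)
    (hLm : ∀ θ ∈ K, Measurable (L θ)) (Hm : 𝓧 → ℝ) (hHm : Measurable Hm) (hHm0 : ∀ x, 0 ≤ Hm x)
    (hlip : ∀ x, ∀ θ ∈ K, ∀ θ' ∈ K, |L θ x - L θ' x| ≤ Hm x * |θ - θ'|)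
    (hexp : ∀ a : ℝ, 0 < a → Integrable (fun x => Real.exp (a * |Hm x|)) ν)
    (hHi : Integrable Hm ν)
    (hneg : ∀ θ ∈ K, θ ≠ θ₀ → ∫ x, (L θ x - L θ₀ x) ∂ν < 0)
    (θhat : ℕ → Ω → ℝ) (hmem : ∀ n ω, θhat n ω ∈ K)
    (hmax : ∀ n ω, 1 ≤ n → ∑ i ∈ Finset.range n, L θ₀ (X i ω) ≤
      ∑ i ∈ Finset.range n, L (θhat n ω) (X i ω)) (δ : ℝ) (hδ : 0 < δ) :
    ExpSmall (fun n => P {ω | δ ≤ |θhat n ω - θ₀|}) := by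
  have hc : IsCompact (K ∩ {t | δ ≤ |t - θ₀|}) :=
    hK.inter_right (isClosed_le continuous_const (by fun_prop))
  have key : ExpSmall (fun n => P {ω | θhat n ω ∈ K ∩ {t | δ ≤ |t - θ₀|}}) := by
    refine hc.induction_on (p := fun S => ExpSmall (fun n => P {ω | θhat n ω ∈ S})) ?_ ?_ ?_ ?_
    · simpa using ExpSmall.zero
    · intro S T hST hT
      exact hT.mono fun n _ => measure_mono fun ω hω => hST hω
    · intro S T hS hT
      refine (hS.add hT).mono fun n _ => ?_
      exact (measure_mono (fun ω hω => hω)).trans (measure_union_le _ _)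
    · rintro θ' ⟨hθ'K, hθ'δ⟩
      have hne : θ' ≠ θ₀ := by
        rintro rfl
        simp at hθ'δ; linarith
      have hm := hneg θ' hθ'K hne
      set m := ∫ x, (L θ' x - L θ₀ x) ∂ν with hmdef
      set E := ∫ x, Hm x ∂ν with hE
      have hE0 : 0 ≤ E := integral_nonneg hHm0
      set r := -m / (2 * (E + 1)) with hr
      have hr0 : 0 < r := div_pos (by linarith) (by positivity)
      have hrE : r * (2 * (E + 1)) = -m := by rw [hr]; field_simp
      have hLi : Integrable (fun x => L θ' x - L θ₀ x) ν := by
        refine (hHi.mul_const |θ' - θ₀|).mono'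
          ((hLm θ' hθ'K).sub (hLm θ₀ hθ₀)).aestronglyMeasurable (ae_of_all _ fun x => ?_)
        exact hlip x θ' hθ'K θ₀ hθ₀
      have hYm : Measurable (fun x => L θ' x - L θ₀ x + r * Hm x) :=
        ((hLm θ' hθ'K).sub (hLm θ₀ hθ₀)).add (hHm.const_mul r)
      have hYneg : ∫ x, (L θ' x - L θ₀ x + r * Hm x) ∂ν < 0 := by
        rw [integral_add hLi (hHi.const_mul r), integral_const_mul]
        nlinarith
      have hYb : ∀ x, |L θ' x - L θ₀ x + r * Hm x| ≤ (|θ' - θ₀| + r) * |Hm x| := by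
        intro x
        have h1 := abs_add_le (L θ' x - L θ₀ x) (r * Hm x)
        have h2 := hlip x θ' hθ'K θ₀ hθ₀
        rw [abs_of_nonneg (mul_nonneg hr0.le (hHm0 x))] at h1
        rw [abs_of_nonneg (hHm0 x)]
        nlinarith
      have hch := chernoff P ν X hXm hXi hXl (fun x => L θ' x - L θ₀ x + r * Hm x) hYm
        ⟨1, one_pos, by
          refine (hexp (|θ' - θ₀| + r) (by positivity)).mono' (by fun_prop) (ae_of_all _ fun x => ?_)
          rw [Real.norm_eq_abs, abs_of_pos (Real.exp_pos _), one_mul]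
          exact Real.exp_le_exp.2 (hYb x)⟩ hYneg
      refine ⟨Metric.ball θ' r ∩ (K ∩ {t | δ ≤ |t - θ₀|}),
        Filter.inter_mem (mem_nhdsWithin_of_mem_nhds (Metric.ball_mem_nhds _ hr0))
          self_mem_nhdsWithin, ?_⟩
      refine (ExpSmall.of_chernoff hch).mono fun n hn => measure_mono ?_
      rintro ω ⟨hω, -⟩
      change 0 ≤ ∑ i ∈ Finset.range n, (L θ' (X i ω) - L θ₀ (X i ω) + r * Hm (X i ω))
      have h1 := hmax n ω hn
      have h2 : ∑ i ∈ Finset.range n, L (θhat n ω) (X i ω) ≤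
          ∑ i ∈ Finset.range n, (L θ' (X i ω) + r * Hm (X i ω)) := by
        refine Finset.sum_le_sum fun i _ => ?_
        have a := (abs_le.1 (hlip (X i ω) _ (hmem n ω) θ' hθ'K)).2
        have b : |θhat n ω - θ'| ≤ r := by
          have : dist (θhat n ω) θ' < r := hω
          rw [Real.dist_eq] at this
          exact this.le
        have := mul_le_mul_of_nonneg_left b (hHm0 (X i ω))
        linarith
      have h3 : ∑ i ∈ Finset.range n, (L θ' (X i ω) - L θ₀ (X i ω) + r * Hm (X i ω))
          = ∑ i ∈ Finset.range n, (L θ' (X i ω) + r * Hm (X i ω))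
            - ∑ i ∈ Finset.range n, L θ₀ (X i ω) := by
        rw [← Finset.sum_sub_distrib]
        exact Finset.sum_congr rfl fun i _ => by ring
      rw [h3]; linarith
  exact key.mono fun n _ => measure_mono fun ω hω => ⟨hmem n ω, hω⟩

lemma nu_integral {𝓧 : Type*} [MeasurableSpace 𝓧] (μ : Measure 𝓧) (q : 𝓧 → ℝ) (hq : Measurable q)
    (hq0 : ∀ x, 0 < q x) (g : 𝓧 → ℝ) :
    ∫ x, g x ∂(μ.withDensity (fun x => ENNReal.ofReal (q x))) = ∫ x, g x * q x ∂μ := by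
  rw [integral_withDensity_eq_integral_toReal_smul (by fun_prop) (ae_of_all _ fun x => by simp)]
  refine integral_congr_ae (ae_of_all _ fun x => ?_)
  simp only [ENNReal.toReal_ofReal (hq0 x).le, smul_eq_mul]
  ring

lemma nu_integrable {𝓧 : Type*} [MeasurableSpace 𝓧] (μ : Measure 𝓧) (q : 𝓧 → ℝ)
    (hq : Measurable q) (hq0 : ∀ x, 0 < q x) (g : 𝓧 → ℝ) :
    Integrable g (μ.withDensity (fun x => ENNReal.ofReal (q x)))
      ↔ Integrable (fun x => g x * q x) μ := by
  rw [integrable_withDensity_iff (by fun_prop) (ae_of_all _ fun x => by simp)]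
  simp only [ENNReal.toReal_ofReal (hq0 _).le]

lemma nu_ae {𝓧 : Type*} [MeasurableSpace 𝓧] (μ : Measure 𝓧) (q : 𝓧 → ℝ)
    (hq : Measurable q) (hq0 : ∀ x, 0 < q x) :
    ae (μ.withDensity (fun x => ENNReal.ofReal (q x))) = ae μ := by
  ext s
  have : (∀ᵐ x ∂(μ.withDensity (fun x => ENNReal.ofReal (q x))), x ∈ s) ↔ ∀ᵐ x ∂μ, x ∈ s := by
    rw [ae_withDensity_iff (by fun_prop)]
    simp [hq0]
  exact this

lemma nu_prob {𝓧 : Type*} [MeasurableSpace 𝓧] (μ : Measure 𝓧) (q : 𝓧 → ℝ)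
    (hq : Measurable q) (hq0 : ∀ x, 0 < q x) (hq1 : ∫ x, q x ∂μ = 1) :
    IsProbabilityMeasure (μ.withDensity (fun x => ENNReal.ofReal (q x))) := by
  constructor
  rw [withDensity_apply _ MeasurableSet.univ, Measure.restrict_univ,
    ← ofReal_integral_eq_lintegral_ofReal, hq1, ENNReal.ofReal_one]
  · by_contra h
    rw [integral_undef h] at hq1
    norm_num at hq1
  · exact ae_of_all _ fun x => (hq0 x).le

lemma gibbs {𝓧 : Type*} [MeasurableSpace 𝓧] (μ : Measure 𝓧) (p q : 𝓧 → ℝ)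
    (hp : Measurable p) (hq : Measurable q) (hp0 : ∀ x, 0 < p x) (hq0 : ∀ x, 0 < q x)
    (hp1 : ∫ x, p x ∂μ = 1) (hq1 : ∫ x, q x ∂μ = 1)
    (hi : Integrable (fun x => Real.log (p x) - Real.log (q x))
      (μ.withDensity (fun x => ENNReal.ofReal (q x))))
    (hge : 0 ≤ ∫ x, (Real.log (p x) - Real.log (q x))
      ∂(μ.withDensity (fun x => ENNReal.ofReal (q x)))) : p =ᵐ[μ] q := by
  have hprob := nu_prob μ q hq hq0 hq1
  set ν := μ.withDensity (fun x => ENNReal.ofReal (q x)) with hν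
  have hae : ae ν = ae μ := nu_ae μ q hq hq0
  have e1 : ∀ x, p x / q x * q x = p x := fun x => div_mul_cancel₀ _ (hq0 x).ne'
  have hg : Integrable (fun x => p x / q x) ν := by
    rw [hν, nu_integrable μ q hq hq0]
    simp only [e1]
    by_contra h
    rw [integral_undef h] at hp1
    norm_num at hp1
  have hg1 : ∫ x, p x / q x ∂ν = 1 := by
    rw [hν, nu_integral μ q hq hq0]
    simp only [e1, hp1]
  have elog : ∀ x, Real.log (p x) - Real.log (q x) = Real.log (p x / q x) := fun x =>
    (Real.log_div (hp0 x).ne' (hq0 x).ne').symm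
  have hnn : ∀ x, 0 ≤ (p x / q x - 1) - (Real.log (p x) - Real.log (q x)) := by
    intro x
    rw [elog]
    have := Real.log_le_sub_one_of_pos (div_pos (hp0 x) (hq0 x))
    linarith
  have hI2 : Integrable (fun x => (p x / q x - 1) - (Real.log (p x) - Real.log (q x))) ν :=
    (hg.sub (integrable_const 1)).sub hi
  have hitg : ∫ x, ((p x / q x - 1) - (Real.log (p x) - Real.log (q x))) ∂ν ≤ 0 := by
    have h2 : ∫ x, (p x / q x - 1) ∂ν = 0 := by
      rw [integral_sub hg (integrable_const 1), hg1]; simp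
    have i2 : Integrable (fun x => p x / q x - 1) ν := hg.sub (integrable_const 1)
    rw [integral_sub i2 hi, h2]
    linarith
  have h0 := (integral_eq_zero_iff_of_nonneg hnn hI2).1
    (le_antisymm hitg (integral_nonneg hnn))
  have h0' : ∀ᵐ x ∂μ, (p x / q x - 1) - (Real.log (p x) - Real.log (q x)) = 0 := by
    rw [← hae]; exact h0
  filter_upwards [h0'] with x hx
  rw [elog] at hx
  by_contra hne
  have : p x / q x ≠ 1 := by
    intro h
    rw [div_eq_one_iff_eq (hq0 x).ne'] at h
    exact hne h
  have := Real.log_lt_sub_one_of_pos (div_pos (hp0 x) (hq0 x)) this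
  linarith

lemma lip_env {𝓧 : Type*} [MeasurableSpace 𝓧] (K : Set ℝ) (hKne : K.Nonempty) (L : ℝ → 𝓧 → ℝ)
    (hLm : ∀ θ ∈ K, Measurable (L θ)) (H : 𝓧 → ℝ) (hH0 : ∀ x, 0 ≤ H x)
    (hlip : ∀ x, ∀ θ ∈ K, ∀ θ' ∈ K, |L θ x - L θ' x| ≤ H x * |θ - θ'|) :
    ∃ Hm : 𝓧 → ℝ, Measurable Hm ∧ (∀ x, 0 ≤ Hm x) ∧ (∀ x, Hm x ≤ H x) ∧
      ∀ x, ∀ θ ∈ K, ∀ θ' ∈ K, |L θ x - L θ' x| ≤ Hm x * |θ - θ'| := by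
  have hne : Nonempty K := hKne.to_subtype
  set u : ℕ → K := TopologicalSpace.denseSeq K with hu
  have hud : DenseRange u := TopologicalSpace.denseRange_denseSeq K
  set φ : ℕ × ℕ → 𝓧 → ℝ := fun p x =>
    |L (u p.1) x - L (u p.2) x| / |(u p.1 : ℝ) - u p.2| with hφ
  have hφH : ∀ p x, φ p x ≤ H x := by
    intro p x
    exact div_le_of_le_mul₀ (abs_nonneg _) (hH0 x) (hlip x _ (u p.1).2 _ (u p.2).2)
  have hφ0 : ∀ p x, 0 ≤ φ p x := fun p x => by positivity
  have hbdd : ∀ x, BddAbove (Set.range fun p => φ p x) := fun x =>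
    ⟨H x, by rintro _ ⟨p, rfl⟩; exact hφH p x⟩
  refine ⟨fun x => ⨆ p, φ p x, ?_, ?_, ?_, ?_⟩
  · refine Measurable.iSup fun p => ?_
    have h1 := hLm _ (u p.1).2
    have h2 := hLm _ (u p.2).2
    exact (continuous_abs.measurable.comp (h1.sub h2)).div_const _
  · exact fun x => Real.iSup_nonneg fun p => hφ0 p x
  · exact fun x => ciSup_le fun p => hφH p x
  · intro x θ hθ θ' hθ'
    have hLc : Continuous (fun a : K => L a x) := by
      refine LipschitzWith.continuous (K := (H x).toNNReal) ?_
      refine LipschitzWith.of_dist_le_mul fun a b => ?_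
      rw [Real.dist_eq, Real.coe_toNNReal _ (hH0 x), Subtype.dist_eq, Real.dist_eq]
      exact hlip x _ a.2 _ b.2
    have hcl : IsClosed {p : K × K | |L p.1 x - L p.2 x| ≤ (⨆ p, φ p x) * |(p.1 : ℝ) - p.2|} := by
      refine isClosed_le ?_ ?_
      · exact ((hLc.comp continuous_fst).sub (hLc.comp continuous_snd)).abs
      · fun_prop
    have := hud.induction_on₂ (p := fun a b : K => |L a x - L b x| ≤ (⨆ p, φ p x) * |(a : ℝ) - b|)
      hcl ?_ ⟨θ, hθ⟩ ⟨θ', hθ'⟩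
    · exact this
    · intro i j
      have h1 := le_ciSup (hbdd x) (i, j)
      by_cases hij : (u i : ℝ) = u j
      · have : u i = u j := Subtype.ext hij
        rw [this]; simp
      · have : 0 < |(u i : ℝ) - u j| := abs_pos.2 (sub_ne_zero.2 hij)
        exact (div_le_iff₀ this).1 h1

lemma deriv_aem {𝓧 : Type*} [MeasurableSpace 𝓧] (μ : Measure 𝓧) (g : ℝ → 𝓧 → ℝ) (Θ : Set ℝ)
    (hΘ : IsOpen Θ) (θ : ℝ) (hθ : θ ∈ Θ) (hg : ∀ t ∈ Θ, AEMeasurable (g t) μ)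
    (hd : ∀ᵐ x ∂μ, DifferentiableAt ℝ (fun t => g t x) θ) :
    AEMeasurable (fun x => deriv (fun t => g t x) θ) μ := by
  obtain ⟨r, hr, hball⟩ := Metric.isOpen_iff.1 hΘ θ hθ
  set h : ℕ → ℝ := fun k => r / (k + 2) with hh
  have hpos : ∀ k, 0 < h k := fun k => by positivity
  have hlt : ∀ k, h k < r := fun k => by
    rw [hh]
    refine div_lt_self hr ?_
    have : (0:ℝ) ≤ k := Nat.cast_nonneg k
    linarith
  have hlim : Tendsto h atTop (nhdsWithin 0 {0}ᶜ) := by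
    refine tendsto_nhdsWithin_iff.2 ⟨?_, Eventually.of_forall fun k => (hpos k).ne'⟩
    refine Tendsto.div_atTop tendsto_const_nhds ?_
    exact tendsto_atTop_add_const_right _ _ tendsto_natCast_atTop_atTop
  refine aemeasurable_of_tendsto_metrizable_ae atTop
    (f := fun k x => (h k)⁻¹ * (g (θ + h k) x - g θ x)) ?_ ?_
  · intro k
    refine ((hg _ ?_).sub (hg θ hθ)).const_mul _
    apply hball
    rw [Metric.mem_ball, Real.dist_eq]
    simpa [abs_of_pos (hpos k)] using hlt k
  · filter_upwards [hd] with x hx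
    have := hasDerivAt_iff_tendsto_slope_zero.1 hx.hasDerivAt
    exact this.comp hlim

lemma mvt_bd (φ φ' : ℝ → ℝ) (C h : ℝ) (h0 : φ 0 = 0)
    (hd : ∀ t, |t| ≤ |h| → HasDerivAt φ (φ' t) t) (hb : ∀ t, |t| ≤ |h| → |φ' t| ≤ C) :
    |φ h| ≤ C * |h| := by
  have := Convex.norm_image_sub_le_of_norm_hasDerivWithin_le (f := φ) (f' := φ') (C := C)
    (s := Set.Icc (-|h|) |h|) (x := 0) (y := h)
    (fun t ht => (hd t (abs_le.2 ht)).hasDerivWithinAt) (fun t ht => hb t (abs_le.2 ht))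
    (convex_Icc _ _) ⟨by simp, by simp⟩ ⟨neg_abs_le h, le_abs_self h⟩
  simpa [h0] using this

lemma local_env {𝓧 : Type*} [MeasurableSpace 𝓧] (μ : Measure 𝓧) (L : ℝ → 𝓧 → ℝ) (Θ : Set ℝ)
    (hΘ : IsOpen Θ) (θ₀ : ℝ) (δ : ℝ) (hδ : 0 < δ) (hball : Metric.ball θ₀ δ ⊆ Θ)
    (hLm : ∀ θ ∈ Θ, Measurable (L θ))
    (hsm : ∀ᵐ x ∂μ, (∀ θ ∈ Θ, DifferentiableAt ℝ (fun t => L t x) θ) ∧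
      (∀ θ ∈ Θ, DifferentiableAt ℝ (deriv (fun t => L t x)) θ))
    (s : ℝ → 𝓧 → ℝ) (hs : ∀ θ x, s θ x = deriv (fun t => L t x) θ)
    (Hbar : 𝓧 → ℝ) (hH0 : ∀ x, 0 ≤ Hbar x)
    (hHlip : ∀ x, ∀ θ ∈ Θ,
      |deriv (fun t => s t x) θ₀ - deriv (fun t => s t x) θ| ≤ Hbar x * |θ - θ₀|) :
    ∃ s0 d0 Q : 𝓧 → ℝ, Measurable s0 ∧ Measurable d0 ∧ Measurable Q ∧
      ∀ᵐ x ∂μ, s0 x = s θ₀ x ∧ d0 x = deriv (fun t => s t x) θ₀ ∧ 0 ≤ Q x ∧ Q x ≤ Hbar x ∧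
        (∀ h, |h| < δ → HasDerivAt (fun t => L t x) (s (θ₀ + h) x) (θ₀ + h)) ∧
        (∀ h, |h| < δ → |s (θ₀ + h) x - s0 x - d0 x * h| ≤ Q x * h ^ 2) ∧
        (∀ h, |h| < δ → |L (θ₀ + h) x - L θ₀ x - h * s0 x - h ^ 2 * d0 x / 2| ≤ Q x * |h| ^ 3) := by
  have hmemΘ : ∀ h, |h| < δ → θ₀ + h ∈ Θ := fun h hh => hball (by
    rw [Metric.mem_ball, Real.dist_eq]; simpa using hh)
  have hθ₀ : θ₀ ∈ Θ := by simpa using hmemΘ 0 (by simpa using hδ)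
  have hsfun : ∀ x, (fun t => s t x) = deriv (fun t => L t x) := fun x => funext fun t => hs t x
  have hsm1 : ∀ θ ∈ Θ, AEMeasurable (s θ) μ := by
    intro θ hθ
    have := deriv_aem μ L Θ hΘ θ hθ (fun t ht => (hLm t ht).aemeasurable)
      (by filter_upwards [hsm] with x hx using hx.1 θ hθ)
    refine this.congr (ae_of_all _ fun x => (hs θ x).symm)
  have hdm : AEMeasurable (fun x => deriv (fun t => s t x) θ₀) μ := by
    refine deriv_aem μ s Θ hΘ θ₀ hθ₀ hsm1 ?_
    filter_upwards [hsm] with x hx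
    rw [hsfun]; exact hx.2 θ₀ hθ₀
  set φ : ℚ → 𝓧 → ℝ := fun q x => if |(q:ℝ)| < δ then
    |s (θ₀ + q) x - s θ₀ x - deriv (fun t => s t x) θ₀ * q| / (q:ℝ) ^ 2 else 0 with hφ
  have hφm : ∀ q, AEMeasurable (φ q) μ := by
    intro q
    by_cases hq : |(q:ℝ)| < δ
    · simp only [hφ, hq, if_true]
      have := (((hsm1 _ (hmemΘ q hq)).sub (hsm1 θ₀ hθ₀)).sub (hdm.mul_const (q:ℝ)))
      exact (continuous_abs.measurable.comp_aemeasurable this).div_const _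
    · simp only [hφ, hq, if_false]
      exact aemeasurable_const
  have hQm : AEMeasurable (fun x => ⨆ q, φ q x) μ := AEMeasurable.iSup hφm
  refine ⟨(hsm1 θ₀ hθ₀).mk _, hdm.mk _, hQm.mk _, (hsm1 θ₀ hθ₀).measurable_mk, hdm.measurable_mk,
    hQm.measurable_mk, ?_⟩
  filter_upwards [hsm, (hsm1 θ₀ hθ₀).ae_eq_mk, hdm.ae_eq_mk, hQm.ae_eq_mk] with x hx e1 e2 e3
  rw [← e1, ← e2, ← e3]
  have hder : ∀ h, |h| < δ → HasDerivAt (fun t => L t x) (s (θ₀ + h) x) (θ₀ + h) := by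
    intro h hh
    rw [hs]; exact (hx.1 _ (hmemΘ h hh)).hasDerivAt
  have hder2 : ∀ h, |h| < δ → HasDerivAt (fun t => s t x) (deriv (fun t => s t x) (θ₀ + h))
      (θ₀ + h) := by
    intro h hh
    have := hx.2 _ (hmemΘ h hh)
    rw [← hsfun] at this
    exact this.hasDerivAt
  set d := deriv (fun t => s t x) θ₀ with hd
  have hbound : ∀ h, |h| < δ → |s (θ₀ + h) x - s θ₀ x - d * h| ≤ Hbar x * h ^ 2 := by
    intro h hh
    have := mvt_bd (fun t => s (θ₀ + t) x - s θ₀ x - d * t)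
      (fun t => deriv (fun t => s t x) (θ₀ + t) - d) (Hbar x * |h|) h (by simp) ?_ ?_
    · rw [mul_assoc, abs_mul_abs_self, ← sq] at this
      exact this
    · intro t ht
      have h1 := (hder2 t (ht.trans_lt hh)).comp_const_add θ₀ t
      have h2 := ((h1.sub_const (s θ₀ x)).sub ((hasDerivAt_id t).const_mul d))
      refine h2.congr_deriv ?_
      simp
    · intro t ht
      have := hHlip x (θ₀ + t) (hmemΘ t (ht.trans_lt hh))
      rw [abs_sub_comm] at this
      refine this.trans ?_
      have : |θ₀ + t - θ₀| ≤ |h| := by simpa using ht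
      exact mul_le_mul_of_nonneg_left this (hH0 x)
  have hφ0 : ∀ q, 0 ≤ φ q x := by
    intro q
    simp only [hφ]
    split_ifs
    · positivity
    · exact le_rfl
  have hφH : ∀ q, φ q x ≤ Hbar x := by
    intro q
    simp only [hφ]
    split_ifs with hq
    · exact div_le_of_le_mul₀ (sq_nonneg _) (hH0 x) (hbound q hq)
    · exact hH0 x
  have hQ0 : 0 ≤ ⨆ q, φ q x := Real.iSup_nonneg hφ0
  have hQb : ∀ h, |h| < δ → |s (θ₀ + h) x - s θ₀ x - d * h| ≤ (⨆ q, φ q x) * h ^ 2 := by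
    intro h hh
    have hev : ∀ q : ℚ, |(q:ℝ)| < δ → |s (θ₀ + q) x - s θ₀ x - d * q| ≤ (⨆ q, φ q x) * (q:ℝ) ^ 2 := by
      intro q hq
      have h1 : φ q x ≤ ⨆ q, φ q x :=
        le_ciSup (f := fun q => φ q x) ⟨Hbar x, by rintro _ ⟨p, rfl⟩; exact hφH p⟩ q
      by_cases h0 : (q:ℝ) = 0
      · rw [h0]; simp
      · have h2 : 0 < (q:ℝ) ^ 2 := by positivity
        simp only [hφ, hq, if_true] at h1
        exact (div_le_iff₀ h2).1 h1
    have hc1 : ContinuousAt (fun t => |s (θ₀ + t) x - s θ₀ x - d * t|) h := by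
      have := ((hder2 h hh).comp_const_add θ₀ h).continuousAt
      have h3 : ContinuousAt (fun t : ℝ => d * t) h := by fun_prop
      exact ((this.sub continuousAt_const).sub h3).abs
    have hc2 : ContinuousAt (fun t : ℝ => (⨆ q, φ q x) * t ^ 2) h := by fun_prop
    obtain ⟨v, hv⟩ : ∃ v : ℕ → ℚ, Tendsto (fun k => ((v k : ℚ) : ℝ)) atTop (nhds h) := by
      have hmem : h ∈ closure (Set.range ((↑) : ℚ → ℝ)) := Rat.denseRange_cast h
      obtain ⟨w, hw, hw2⟩ := mem_closure_iff_seq_limit.1 hmem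
      choose v hv using hw
      exact ⟨v, by simpa [hv] using hw2⟩
    have hevt : ∀ᶠ k in atTop, |((v k : ℚ) : ℝ)| < δ :=
      (hv.abs).eventually (gt_mem_nhds hh)
    exact le_of_tendsto_of_tendsto (hc1.tendsto.comp hv) (hc2.tendsto.comp hv)
      (hevt.mono fun k hk => hev (v k) hk)
  refine ⟨rfl, rfl, hQ0, ciSup_le hφH, hder, hQb, ?_⟩
  intro h hh
  have := mvt_bd (fun t => L (θ₀ + t) x - L θ₀ x - t * s θ₀ x - t ^ 2 * d / 2)
      (fun t => s (θ₀ + t) x - s θ₀ x - d * t) ((⨆ q, φ q x) * h ^ 2) h (by simp) ?_ ?_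
  · refine this.trans (le_of_eq ?_)
    rw [← sq_abs h]; ring
  · intro t ht
    have h1 := (hder t (ht.trans_lt hh)).comp_const_add θ₀ t
    have h2 := ((h1.sub_const (L θ₀ x)).sub ((hasDerivAt_id t).mul_const (s θ₀ x))).sub
      ((((hasDerivAt_id t).pow 2).mul_const d).div_const 2)
    refine h2.congr_deriv ?_
    simp
    ring
  · intro t ht
    refine (hQb t (ht.trans_lt hh)).trans ?_
    refine mul_le_mul_of_nonneg_left ?_ hQ0
    exact sq_le_sq.2 ht

lemma exp_rem (y M : ℝ) (hy : |y| ≤ M) (n : ℕ) :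
    |Real.exp y - ∑ m ∈ Finset.range n, y ^ m / (m.factorial : ℝ)| ≤ |y| ^ n * Real.exp M := by
  have h := Complex.norm_exp_sub_sum_le_norm_mul_exp (y : ℂ) n
  have e : Complex.exp (y : ℂ) - ∑ m ∈ Finset.range n, (y : ℂ) ^ m / (m.factorial : ℂ)
      = ((Real.exp y - ∑ m ∈ Finset.range n, y ^ m / (m.factorial : ℝ) : ℝ) : ℂ) := by
    push_cast; rfl
  rw [e, Complex.norm_real, Complex.norm_real, Real.norm_eq_abs, Real.norm_eq_abs] at h
  refine h.trans ?_
  gcongr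

lemma exp_rem1 (y M : ℝ) (hy : |y| ≤ M) : |Real.exp y - 1| ≤ |y| * Real.exp M := by
  simpa using exp_rem y M hy 1

lemma exp_rem2 (y M : ℝ) (hy : |y| ≤ M) : |Real.exp y - 1 - y| ≤ |y| ^ 2 * Real.exp M := by
  have := exp_rem y M hy 2
  simp only [Finset.sum_range_succ, Finset.sum_range_zero] at this
  norm_num at this
  rw [← sub_sub] at this
  simpa using this

lemma exp_rem3 (y M : ℝ) (hy : |y| ≤ M) :
    |Real.exp y - 1 - y - y ^ 2 / 2| ≤ |y| ^ 3 * Real.exp M := by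
  have := exp_rem y M hy 3
  simp only [Finset.sum_range_succ, Finset.sum_range_zero] at this
  norm_num [Nat.factorial] at this
  rw [← sub_sub, ← sub_sub] at this
  simpa using this

lemma pt_all (l h s d Q M : ℝ) (hh : 0 < h) (hh1 : h ≤ 1) (hM : 0 ≤ M) (hQ : 0 ≤ Q)
    (hs : |s| ≤ M) (hl : |l| ≤ M * h) (hq : |l - h * s - h ^ 2 * d / 2| ≤ Q * h ^ 3) :
    |(Real.exp l - 1) / h| ≤ M * Real.exp M ∧
    |(Real.exp l - 1) / h - s| ≤ h * (M ^ 2 * Real.exp M + |d| / 2 + Q) ∧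
    |(Real.exp l - 1 - h * s) / h ^ 2| ≤ M ^ 2 * Real.exp M + |d| / 2 + Q ∧
    |(Real.exp l - 1 - h * s) / h ^ 2 - (s ^ 2 + d) / 2| ≤
      h * (M ^ 3 * Real.exp M + M * (|d| / 2 + Q) + Q) := by
  have hlM : |l| ≤ M := hl.trans (mul_le_of_le_one_right hM hh1)
  have hE := Real.exp_pos M
  have r1 := exp_rem1 l M hlM
  have r2 := exp_rem2 l M hlM
  have r3 := exp_rem3 l M hlM
  have l2 : |l| ^ 2 ≤ M ^ 2 * h ^ 2 := by rw [← mul_pow]; gcongr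
  have l3 : |l| ^ 3 ≤ M ^ 3 * h ^ 3 := by rw [← mul_pow]; gcongr
  have r2b : |Real.exp l - 1 - l| ≤ M ^ 2 * h ^ 2 * Real.exp M := r2.trans (by gcongr)
  have r3b : |Real.exp l - 1 - l - l ^ 2 / 2| ≤ M ^ 3 * h ^ 3 * Real.exp M := r3.trans (by gcongr)
  have hh2 : 0 < h ^ 2 := by positivity
  have q1 : |l - h * s| ≤ h ^ 2 * (|d| / 2 + Q) := by
    have e : l - h * s = (l - h * s - h ^ 2 * d / 2) + h ^ 2 * d / 2 := by ring
    have a := abs_add_le (l - h * s - h ^ 2 * d / 2) (h ^ 2 * d / 2)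
    rw [← e] at a
    have b : |h ^ 2 * d / 2| = h ^ 2 * (|d| / 2) := by
      rw [abs_div, abs_mul, abs_of_pos hh2]; norm_num; ring
    have c : Q * h ^ 3 ≤ Q * h ^ 2 :=
      mul_le_mul_of_nonneg_left (pow_le_pow_of_le_one hh.le hh1 (by norm_num)) hQ
    rw [b] at a
    linarith
  refine ⟨?_, ?_, ?_, ?_⟩
  · rw [abs_div, abs_of_pos hh, div_le_iff₀ hh]
    calc _ ≤ _ := r1
      _ ≤ M * h * Real.exp M := by gcongr
      _ = _ := by ring
  · have e : (Real.exp l - 1) / h - s = ((Real.exp l - 1 - l) + (l - h * s)) / h := by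
      field_simp; ring
    rw [e, abs_div, abs_of_pos hh, div_le_iff₀ hh]
    refine (abs_add_le _ _).trans ?_
    nlinarith
  · have e : Real.exp l - 1 - h * s = (Real.exp l - 1 - l) + (l - h * s) := by ring
    rw [e, abs_div, abs_of_pos hh2, div_le_iff₀ hh2]
    refine (abs_add_le _ _).trans ?_
    nlinarith
  · have e : (Real.exp l - 1 - h * s) / h ^ 2 - (s ^ 2 + d) / 2
        = ((Real.exp l - 1 - l - l ^ 2 / 2) + (l - h * s) * (l + h * s) / 2
          + (l - h * s - h ^ 2 * d / 2)) / h ^ 2 := by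
      field_simp; ring
    rw [e, abs_div, abs_of_pos hh2, div_le_iff₀ hh2]
    have p : |l + h * s| ≤ 2 * (M * h) := by
      have := abs_add_le l (h * s)
      rw [abs_mul, abs_of_pos hh] at this
      have : h * |s| ≤ h * M := by gcongr
      linarith
    have p2 : |(l - h * s) * (l + h * s) / 2| ≤ h ^ 2 * (|d| / 2 + Q) * (M * h) := by
      rw [abs_div, abs_mul]
      have : |l - h * s| * |l + h * s| ≤ h ^ 2 * (|d| / 2 + Q) * (2 * (M * h)) := by
        gcongr
      rw [abs_of_pos (zero_lt_two' ℝ)]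
      linarith
    refine (abs_add_le _ _).trans ?_
    have := abs_add_le (Real.exp l - 1 - l - l ^ 2 / 2) ((l - h * s) * (l + h * s) / 2)
    have e2 : h * (M ^ 3 * Real.exp M + M * (|d| / 2 + Q) + Q) * h ^ 2
      = M ^ 3 * h ^ 3 * Real.exp M + h ^ 2 * (|d| / 2 + Q) * (M * h) + Q * h ^ 3 := by ring
    rw [e2]
    linarith

lemma pow_exp_int {𝓧 : Type*} [MeasurableSpace 𝓧] (ν : Measure 𝓧) (Hm : 𝓧 → ℝ)
    (hHm : Measurable Hm) (hHm0 : ∀ x, 0 ≤ Hm x)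
    (hexp : ∀ a : ℝ, 0 < a → Integrable (fun x => Real.exp (a * |Hm x|)) ν) (k j : ℕ) (hkj : 0 < k + j) :
    Integrable (fun x => Hm x ^ k * Real.exp (j * Hm x)) ν := by
  refine (hexp (k + j) (by exact_mod_cast hkj)).mono' (by fun_prop) (ae_of_all _ fun x => ?_)
  rw [Real.norm_eq_abs, abs_of_nonneg (by have := hHm0 x; positivity), abs_of_nonneg (hHm0 x),
    add_mul, Real.exp_add, Real.exp_nat_mul]
  have h1 : Hm x ≤ Real.exp (Hm x) := by linarith [Real.add_one_le_exp (Hm x)]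
  have := hHm0 x
  gcongr
  rw [Real.exp_nat_mul]
  gcongr

lemma moments {𝓧 : Type*} [MeasurableSpace 𝓧] (ν : Measure 𝓧) [IsProbabilityMeasure ν]
    (ell : ℝ → 𝓧 → ℝ) (Hm s0 d0 Q : 𝓧 → ℝ) (hHm : Measurable Hm) (hs0 : Measurable s0)
    (hHm0 : ∀ x, 0 ≤ Hm x) (hd0 : Measurable d0)
    (hexp : ∀ a : ℝ, 0 < a → Integrable (fun x => Real.exp (a * |Hm x|)) ν)
    (hd0i : Integrable d0 ν) (hQi : Integrable Q ν) (δ : ℝ) (hδ : 0 < δ)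
    (hm : ∀ h, |h| < δ → Measurable (ell h)) (h1 : ∀ h, |h| < δ → ∫ x, Real.exp (ell h x) ∂ν = 1)
    (hb : ∀ x h, |h| < δ → |ell h x| ≤ Hm x * |h|)
    (hae : ∀ᵐ x ∂ν, 0 ≤ Q x ∧ ∀ h, |h| < δ →
      |ell h x - h * s0 x - h ^ 2 * d0 x / 2| ≤ Q x * |h| ^ 3) :
    (∀ᵐ x ∂ν, |s0 x| ≤ Hm x) ∧ ∫ x, s0 x ∂ν = 0 ∧ ∫ x, (s0 x) ^ 2 ∂ν = - ∫ x, d0 x ∂ν := by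
  set η := min δ 1 with hη
  have hη0 : 0 < η := by positivity
  set h : ℕ → ℝ := fun k => η / (k + 2) with hh
  have hpos : ∀ k, 0 < h k := fun k => by positivity
  have hlt : ∀ k, h k < η := fun k => by
    rw [hh]
    refine div_lt_self hη0 ?_
    have : (0:ℝ) ≤ k := Nat.cast_nonneg k
    linarith
  have hk1 : ∀ k, h k ≤ 1 := fun k => (hlt k).le.trans (min_le_right _ _)
  have hkδ : ∀ k, |h k| < δ := fun k => by
    rw [abs_of_pos (hpos k)]
    exact (hlt k).trans_le (min_le_left _ _)
  have hlim : Tendsto h atTop (nhds 0) := by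
    refine Tendsto.div_atTop tendsto_const_nhds ?_
    exact tendsto_atTop_add_const_right _ _ tendsto_natCast_atTop_atTop
  have hsH : ∀ᵐ x ∂ν, |s0 x| ≤ Hm x := by
    filter_upwards [hae] with x hx
    have hk : ∀ k, |s0 x| ≤ Hm x + h k * (|d0 x| / 2) + Q x * h k ^ 2 := by
      intro k
      have a := hx.2 (h k) (hkδ k)
      have b := hb x (h k) (hkδ k)
      rw [abs_of_pos (hpos k)] at a b
      have e : h k * s0 x = ell (h k) x - h k ^ 2 * d0 x / 2
        - (ell (h k) x - h k * s0 x - h k ^ 2 * d0 x / 2) := by ring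
      have c : |h k * s0 x| ≤ Hm x * h k + h k ^ 2 * (|d0 x| / 2) + Q x * h k ^ 3 := by
        rw [e]
        refine (abs_sub _ _).trans ?_
        have t := abs_sub (ell (h k) x) (h k ^ 2 * d0 x / 2)
        have : |h k ^ 2 * d0 x / 2| = h k ^ 2 * (|d0 x| / 2) := by
          rw [abs_div, abs_mul, abs_of_pos (pow_pos (hpos k) 2)]; norm_num; ring
        linarith
      rw [abs_mul, abs_of_pos (hpos k)] at c
      refine le_of_mul_le_mul_left ?_ (hpos k)
      linarith
    refine ge_of_tendsto' (x := atTop) (f := fun k => Hm x + h k * (|d0 x| / 2) + Q x * h k ^ 2) ?_ hk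
    have := ((hlim.mul_const (|d0 x| / 2)).const_add (Hm x)).add ((hlim.pow 2).const_mul (Q x))
    simpa using this
  have hpt : ∀ᵐ x ∂ν, ∀ k, |(Real.exp (ell (h k) x) - 1) / h k| ≤ Hm x * Real.exp (Hm x) ∧
    |(Real.exp (ell (h k) x) - 1) / h k - s0 x| ≤ h k * (Hm x ^ 2 * Real.exp (Hm x) + |d0 x| / 2 + Q x) ∧
    |(Real.exp (ell (h k) x) - 1 - h k * s0 x) / h k ^ 2| ≤ Hm x ^ 2 * Real.exp (Hm x) + |d0 x| / 2 + Q x ∧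
    |(Real.exp (ell (h k) x) - 1 - h k * s0 x) / h k ^ 2 - (s0 x ^ 2 + d0 x) / 2| ≤
      h k * (Hm x ^ 3 * Real.exp (Hm x) + Hm x * (|d0 x| / 2 + Q x) + Q x) := by
    filter_upwards [hae, hsH] with x hx hx2 k
    have a := hx.2 (h k) (hkδ k)
    have b := hb x (h k) (hkδ k)
    rw [abs_of_pos (hpos k)] at a b
    exact pt_all _ _ _ _ _ _ (hpos k) (hk1 k) (hHm0 x) hx.1 hx2 b a
  have i1 : Integrable (fun x => Hm x * Real.exp (Hm x)) ν := by
    simpa using pow_exp_int ν Hm hHm hHm0 hexp 1 1 (by norm_num)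
  have i2 : Integrable (fun x => Hm x ^ 2 * Real.exp (Hm x)) ν := by
    simpa using pow_exp_int ν Hm hHm hHm0 hexp 2 1 (by norm_num)
  have iH : Integrable Hm ν := by
    simpa using pow_exp_int ν Hm hHm hHm0 hexp 1 0 (by norm_num)
  have iH2 : Integrable (fun x => Hm x ^ 2) ν := by
    simpa using pow_exp_int ν Hm hHm hHm0 hexp 2 0 (by norm_num)
  have is0 : Integrable s0 ν := iH.mono' hs0.aestronglyMeasurable hsH
  have is2 : Integrable (fun x => s0 x ^ 2) ν := by
    refine iH2.mono' (by fun_prop) ?_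
    filter_upwards [hsH] with x hx
    rw [Real.norm_eq_abs, abs_pow]
    gcongr
  have iE : ∀ k, Integrable (fun x => Real.exp (ell (h k) x)) ν := by
    intro k
    by_contra hc
    have := h1 (h k) (hkδ k)
    rw [integral_undef hc] at this
    norm_num at this
  have hs00 : ∫ x, s0 x ∂ν = 0 := by
    have t := tendsto_integral_of_dominated_convergence (μ := ν)
      (F := fun k x => (Real.exp (ell (h k) x) - 1) / h k) (f := s0)
      (fun x => Hm x * Real.exp (Hm x)) (fun k => by
        have := hm _ (hkδ k)
        exact Measurable.aestronglyMeasurable (by fun_prop)) i1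
      (fun k => hpt.mono fun x hx => (hx k).1)
      (hpt.mono fun x hx => by
        rw [tendsto_iff_norm_sub_tendsto_zero]
        refine squeeze_zero (fun _ => norm_nonneg _) (fun k => (hx k).2.1) ?_
        simpa using hlim.mul_const (Hm x ^ 2 * Real.exp (Hm x) + |d0 x| / 2 + Q x))
    have e : ∀ k, ∫ x, (Real.exp (ell (h k) x) - 1) / h k ∂ν = 0 := by
      intro k
      rw [integral_div, integral_sub (iE k) (integrable_const 1), h1 _ (hkδ k)]
      simp
    simp only [e] at t
    exact (tendsto_nhds_unique t tendsto_const_nhds)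
  refine ⟨hsH, hs00, ?_⟩
  have t := tendsto_integral_of_dominated_convergence (μ := ν)
      (F := fun k x => (Real.exp (ell (h k) x) - 1 - h k * s0 x) / h k ^ 2)
      (f := fun x => (s0 x ^ 2 + d0 x) / 2)
      (fun x => Hm x ^ 2 * Real.exp (Hm x) + |d0 x| / 2 + Q x) (fun k => by
        have := hm _ (hkδ k)
        exact Measurable.aestronglyMeasurable (by fun_prop)) ((i2.add (hd0i.abs.div_const 2)).add hQi)
      (fun k => hpt.mono fun x hx => (hx k).2.2.1)
      (hpt.mono fun x hx => by
        rw [tendsto_iff_norm_sub_tendsto_zero]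
        refine squeeze_zero (fun _ => norm_nonneg _) (fun k => (hx k).2.2.2) ?_
        simpa using hlim.mul_const (Hm x ^ 3 * Real.exp (Hm x) + Hm x * (|d0 x| / 2 + Q x) + Q x))
  have e : ∀ k, ∫ x, (Real.exp (ell (h k) x) - 1 - h k * s0 x) / h k ^ 2 ∂ν = 0 := by
    intro k
    have i3 : Integrable (fun x => Real.exp (ell (h k) x) - 1) ν := (iE k).sub (integrable_const 1)
    rw [integral_div, integral_sub i3 (is0.const_mul _),
      integral_sub (iE k) (integrable_const 1), h1 _ (hkδ k), integral_const_mul, hs00]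
    simp
  simp only [e] at t
  have t2 := tendsto_nhds_unique t tendsto_const_nhds
  rw [integral_div, integral_add is2 hd0i] at t2
  linarith

lemma bad_small {Ω 𝓧 : Type*} [MeasurableSpace Ω] [MeasurableSpace 𝓧] (P : Measure Ω)
    [IsProbabilityMeasure P] (ν : Measure 𝓧) [IsProbabilityMeasure ν] (X : ℕ → Ω → 𝓧)
    (hXm : ∀ i, Measurable (X i)) (hXi : iIndepFun X P) (hXl : ∀ i, Measure.map (X i) P = ν)
    (K : Set ℝ) (θ₀ : ℝ) (δ0 : ℝ) (hδ0 : 0 < δ0) (hball : Metric.ball θ₀ δ0 ⊆ K)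
    (L s : ℝ → 𝓧 → ℝ) (s0 d0 Q : 𝓧 → ℝ) (hd0 : Measurable d0) (hQ : Measurable Q)
    (hde : ∃ a > 0, Integrable (fun x => Real.exp (a * |d0 x|)) ν)
    (hQe : ∃ a > 0, Integrable (fun x => Real.exp (a * |Q x|)) ν)
    (hdi : Integrable d0 ν) (hQi : Integrable Q ν)
    (I : ℝ) (hI : I = - ∫ x, d0 x ∂ν)
    (hae : ∀ᵐ x ∂ν, 0 ≤ Q x ∧
        (∀ h, |h| < δ0 → HasDerivAt (fun t => L t x) (s (θ₀ + h) x) (θ₀ + h)) ∧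
        (∀ h, |h| < δ0 → |s (θ₀ + h) x - s0 x - d0 x * h| ≤ Q x * h ^ 2))
    (θhat : ℕ → Ω → ℝ)
    (hmax : ∀ n ω, 1 ≤ n → ∀ θ ∈ K, ∑ i ∈ Finset.range n, L θ (X i ω) ≤
      ∑ i ∈ Finset.range n, L (θhat n ω) (X i ω))
    (hcons : ∀ δ : ℝ, 0 < δ → ExpSmall (fun n => P {ω | δ ≤ |θhat n ω - θ₀|}))
    (κ : ℝ) (hκ : 0 < κ) :
    ExpSmall (fun n => P {ω | κ * |θhat n ω - θ₀| <
      |I * (θhat n ω - θ₀) - (n:ℝ)⁻¹ * ∑ i ∈ Finset.range n, s0 (X i ω)|}) := by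
  set E := ∫ x, Q x ∂ν with hE
  have hE0 : 0 ≤ E := integral_nonneg_of_ae (hae.mono fun x hx => hx.1)
  set η := κ / 2 with hη
  have hη0 : 0 < η := by positivity
  set δ := min δ0 (κ / (2 * (E + 1))) with hδ
  have hδpos : 0 < δ := by positivity
  have hδE : (E + 1) * δ ≤ κ / 2 := by
    calc (E + 1) * δ ≤ (E + 1) * (κ / (2 * (E + 1))) := by
          gcongr; exact min_le_right _ _
      _ = κ / 2 := by field_simp
  have hshift : ∀ (Y : 𝓧 → ℝ), Measurable Y → (∃ a > 0, Integrable (fun x => Real.exp (a * |Y x|)) ν) →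
      ∀ c : ℝ, Integrable Y ν → ∫ x, Y x ∂ν < c →
      ExpSmall (fun n => P {ω | 0 ≤ ∑ i ∈ Finset.range n, (Y (X i ω) - c)}) := by
    intro Y hY hYe c hYi hc
    refine ExpSmall.of_chernoff (chernoff P ν X hXm hXi hXl (fun x => Y x - c) (hY.sub_const c) ?_ ?_)
    · obtain ⟨a, ha, hi⟩ := hYe
      refine ⟨a, ha, (hi.mul_const (Real.exp (a * |c|))).mono' (by fun_prop) (ae_of_all _ fun x => ?_)⟩
      rw [Real.norm_eq_abs, abs_of_pos (Real.exp_pos _), ← Real.exp_add, ← mul_add]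
      refine Real.exp_le_exp.2 (mul_le_mul_of_nonneg_left (abs_sub _ _) ha.le)
    · rw [integral_sub hYi (integrable_const c)]
      simp; linarith
  have b1 := hshift Q hQ hQe (E + 1) hQi (by linarith)
  have b2 := hshift d0 hd0 hde (-I + η) hdi (by rw [hI]; linarith)
  have b3 := hshift (fun x => - d0 x) hd0.neg (by simpa using hde) (I + η) hdi.neg
    (by rw [integral_neg, hI]; linarith)
  have hgood : ∀ᵐ ω ∂P, ∀ i, 0 ≤ Q (X i ω) ∧
        (∀ h, |h| < δ0 → HasDerivAt (fun t => L t (X i ω)) (s (θ₀ + h) (X i ω)) (θ₀ + h)) ∧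
        (∀ h, |h| < δ0 → |s (θ₀ + h) (X i ω) - s0 (X i ω) - d0 (X i ω) * h| ≤ Q (X i ω) * h ^ 2) := by
    rw [ae_all_iff]
    intro i
    rw [← hXl i] at hae
    exact ae_of_ae_map (hXm i).aemeasurable hae
  refine ((((hcons δ hδpos).add b1).add b2).add b3).mono fun n hn => ?_
  have hn' : (0:ℝ) < n := by exact_mod_cast hn
  refine le_trans ?_ (le_trans (measure_union_le _ _) (add_le_add_left (le_trans (measure_union_le _ _)
    (add_le_add_left (measure_union_le _ _) _)) _))
  refine measure_mono_ae ?_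
  filter_upwards [hgood] with ω hω hbad
  change κ * |θhat n ω - θ₀| <
      |I * (θhat n ω - θ₀) - (n:ℝ)⁻¹ * ∑ i ∈ Finset.range n, s0 (X i ω)| at hbad
  by_contra hcon
  change ¬ (((_ ∨ _) ∨ _) ∨ _) at hcon
  simp only [not_or] at hcon
  obtain ⟨⟨⟨c0, c1⟩, c2⟩, c3⟩ := hcon
  change ¬ (δ ≤ |θhat n ω - θ₀|) at c0
  change ¬ (0 ≤ ∑ i ∈ Finset.range n, (Q (X i ω) - (E + 1))) at c1
  change ¬ (0 ≤ ∑ i ∈ Finset.range n, (d0 (X i ω) - (-I + η))) at c2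
  change ¬ (0 ≤ ∑ i ∈ Finset.range n, (- d0 (X i ω) - (I + η))) at c3
  rw [Finset.sum_sub_distrib] at c1 c2 c3
  simp only [Finset.sum_const, Finset.card_range, nsmul_eq_mul, Finset.sum_neg_distrib, not_le]
    at c0 c1 c2 c3
  set h := θhat n ω - θ₀ with hh
  have hhδ : |h| < δ0 := c0.trans_le (min_le_left _ _)
  have hθ : θ₀ + h = θhat n ω := by rw [hh]; ring
  have hloc : IsLocalMax (fun t => ∑ i ∈ Finset.range n, L t (X i ω)) (θ₀ + h) := by
    have hmem : Metric.ball θ₀ δ0 ∈ nhds (θ₀ + h) := by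
      refine Metric.isOpen_ball.mem_nhds ?_
      rw [Metric.mem_ball, Real.dist_eq]; simpa using hhδ
    filter_upwards [hmem] with t ht
    rw [hθ]
    exact hmax n ω hn t (hball ht)
  have hzero : ∑ i ∈ Finset.range n, s (θ₀ + h) (X i ω) = 0 :=
    hloc.hasDerivAt_eq_zero (HasDerivAt.fun_sum fun i _ => (hω i).2.1 h hhδ)
  set Ss := ∑ i ∈ Finset.range n, s0 (X i ω) with hSs
  set Sd := ∑ i ∈ Finset.range n, d0 (X i ω) with hSd
  set SQ := ∑ i ∈ Finset.range n, Q (X i ω) with hSQ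
  have hsum : |-Ss - Sd * h| ≤ SQ * h ^ 2 := by
    have e : -Ss - Sd * h = ∑ i ∈ Finset.range n, (s (θ₀ + h) (X i ω) - s0 (X i ω) - d0 (X i ω) * h) := by
      rw [Finset.sum_sub_distrib, Finset.sum_sub_distrib, hzero, ← Finset.sum_mul]
      ring
    rw [e, hSQ, Finset.sum_mul]
    exact (Finset.abs_sum_le_sum_abs _ _).trans (Finset.sum_le_sum fun i _ => (hω i).2.2 h hhδ)
  have hdd : |Sd + n * I| ≤ n * η := by
    rw [abs_le]; constructor <;> linarith
  have e2 : I * h - (n:ℝ)⁻¹ * Ss = (n:ℝ)⁻¹ * ((-Ss - Sd * h) + (Sd + n * I) * h) := by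
    field_simp; ring
  rw [e2, abs_mul, abs_of_pos (inv_pos.2 hn')] at hbad
  have f1 : |(-Ss - Sd * h) + (Sd + n * I) * h| ≤ n * (κ * |h|) := by
    refine (abs_add_le _ _).trans ?_
    rw [abs_mul]
    have g1 : SQ * h ^ 2 ≤ n * (E + 1) * (δ * |h|) := by
      have : h ^ 2 ≤ δ * |h| := by
        rw [← sq_abs, sq]; gcongr
      have hp : 0 ≤ n * (E + 1) := by positivity
      calc SQ * h ^ 2 ≤ n * (E + 1) * h ^ 2 := by
            refine mul_le_mul_of_nonneg_right (by linarith) (sq_nonneg _)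
        _ ≤ _ := mul_le_mul_of_nonneg_left this hp
    have g2 : |Sd + n * I| * |h| ≤ n * η * |h| := by gcongr
    have g3 : n * (E + 1) * (δ * |h|) ≤ n * (κ / 2) * |h| := by
      have : n * (E + 1) * (δ * |h|) = n * ((E + 1) * δ) * |h| := by ring
      rw [this]; gcongr
    have : n * (κ / 2) * |h| + n * η * |h| = n * (κ * |h|) := by rw [hη]; ring
    linarith
  have : (n:ℝ)⁻¹ * |(-Ss - Sd * h) + (Sd + n * I) * h| ≤ κ * |h| := by
    rw [inv_mul_le_iff₀ hn']; exact f1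
  linarith

lemma int_of_exp {𝓧 : Type*} [MeasurableSpace 𝓧] (ν : Measure 𝓧) (Y : 𝓧 → ℝ) (hY : Measurable Y)
    (h : ∃ a > 0, Integrable (fun x => Real.exp (a * |Y x|)) ν) : Integrable Y ν := by
  obtain ⟨a, ha, hi⟩ := h
  refine (hi.const_mul a⁻¹).mono' hY.aestronglyMeasurable (ae_of_all _ fun x => ?_)
  have := Real.add_one_le_exp (a * |Y x|)
  rw [Real.norm_eq_abs, ← div_eq_inv_mul, le_div_iff₀ ha]
  linarith


theorem stmt5
    -- the sample space with a σ-finite base measure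
    {𝓧 : Type*} [MeasurableSpace 𝓧] (μ : Measure 𝓧) [SigmaFinite μ]
    -- the parameter set: open, with compact closure K bounded by B
    (Θ : Set ℝ) (hΘopen : IsOpen Θ) (K : Set ℝ) (hK : K = closure Θ)
    (hKcpt : IsCompact K) (B : ℝ) (hB : ∀ θ ∈ K, |θ| ≤ B)
    -- the statistical model: positive densities, measurable, integrating to one
    (f : ℝ → 𝓧 → ℝ)
    (hf_pos : ∀ θ ∈ K, ∀ x, 0 < f θ x)
    (hf_meas : ∀ θ ∈ K, Measurable (f θ))
    (hf_prob : ∀ θ ∈ K, ∫ x, f θ x ∂μ = 1)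
    -- a.e. smoothness: θ ↦ log f(x|θ) is twice differentiable on Θ, continuous on K
    (hf_smooth : ∀ᵐ x ∂μ,
      (∀ θ ∈ Θ, DifferentiableAt ℝ (fun t => Real.log (f t x)) θ) ∧
      (∀ θ ∈ Θ, DifferentiableAt ℝ (deriv (fun t => Real.log (f t x))) θ) ∧
      ContinuousOn (fun t => Real.log (f t x)) K)
    -- identifiability
    (hident : ∀ θ ∈ K, ∀ θ' ∈ K, f θ =ᵐ[μ] f θ' → θ = θ')
    -- the true parameter
    (θ₀ : ℝ) (hθ₀ : θ₀ ∈ Θ)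
    -- the score function
    (s : ℝ → 𝓧 → ℝ) (hs : ∀ θ x, s θ x = deriv (fun t => Real.log (f t x)) θ)
    -- the Fisher information at θ₀: finite and strictly positive
    (IFi : ℝ) (hIFi_int : Integrable (fun x => deriv (fun t => s t x) θ₀ * f θ₀ x) μ)
    (hIFi : IFi = -∫ x, deriv (fun t => s t x) θ₀ * f θ₀ x ∂μ) (hIFi_pos : 0 < IFi)
    -- the i.i.d. samples X₁, X₂, … with density f(·|θ₀)
    {Ω : Type*} [MeasurableSpace Ω] (P : Measure Ω) [IsProbabilityMeasure P]
    (X : ℕ → Ω → 𝓧) (hX_meas : ∀ i, Measurable (X i))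
    (hX_indep : iIndepFun X P)
    (hX_law : ∀ i, Measure.map (X i) P = μ.withDensity (fun x => ENNReal.ofReal (f θ₀ x)))
    -- the maximum likelihood estimator θ̂ₙ, a measurable maximizer of Lₙ over K
    (θhat : ℕ → Ω → ℝ) (hθhat_meas : ∀ n, Measurable (θhat n))
    (hθhat_mem : ∀ (n : ℕ) (ω : Ω), θhat n ω ∈ K)
    (hθhat_max : ∀ (n : ℕ) (ω : Ω), ∀ θ ∈ K,
      (1 / (n : ℝ)) * ∑ i ∈ Finset.range n, Real.log (f θ (X i ω)) ≤
      (1 / (n : ℝ)) * ∑ i ∈ Finset.range n, Real.log (f (θhat n ω) (X i ω)))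
    -- Assumption 1: sub-Gaussian Lipschitz envelope for the log-likelihood
    (H : 𝓧 → ℝ) (hH_nonneg : ∀ x, 0 ≤ H x)
    (hH_lip : ∀ x, ∀ θ ∈ K, ∀ θ' ∈ K,
      |Real.log (f θ x) - Real.log (f θ' x)| ≤ H x * |θ - θ'|)
    (hH_subG : SubGaussianTail P (fun ω => H (X 0 ω)))
    -- Assumption 2: sub-exponential control of the score derivative
    (Hbar : 𝓧 → ℝ) (hHbar_nonneg : ∀ x, 0 ≤ Hbar x)
    (hHbar_lip : ∀ x, ∀ θ ∈ K,
      |deriv (fun t => s t x) θ₀ - deriv (fun t => s t x) θ| ≤ Hbar x * |θ - θ₀|)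
    (hscore_subE : SubExponentialTail P (fun ω => deriv (fun t => s t (X 0 ω)) θ₀))
    (hHbar_subE : SubExponentialTail P (fun ω => Hbar (X 0 ω)))
    -- the normalized estimation error
    (Z : ℕ → Ω → ℝ)
    (hZ : ∀ (n : ℕ) (ω : Ω), Z n ω = Real.sqrt (IFi * n) * (θhat n ω - θ₀))
    -- an auxiliary standard Gaussian random variable, independent of each Z_n
    (G : Ω → ℝ) (hG_meas : Measurable G)
    (hG_law : Measure.map G P = gaussianReal 0 1)
    (hG_indep : ∀ n : ℕ, IndepFun G (Z n) P)
    -- the smoothing parameter and the smoothed estimator Z̃_n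
    (ε : ℝ) (hε : ε ∈ Set.Ioo (0 : ℝ) 1)
    (Ztil : ℕ → Ω → ℝ)
    (hZtil : ∀ (n : ℕ) (ω : Ω),
      Ztil n ω = Real.sqrt (1 - ε) * Z n ω + Real.sqrt ε * G ω) :
    -- STATEMENT: entropic CLT for the smoothed estimator
    Tendsto (fun n => klDiv (Measure.map (Ztil n) P) (gaussianReal 0 1)) atTop
      (nhds (0 : EReal)) := by

  have hΘK : Θ ⊆ K := hK ▸ subset_closure
  have hθ₀K : θ₀ ∈ K := hΘK hθ₀
  set L : ℝ → 𝓧 → ℝ := fun θ x => Real.log (f θ x) with hL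
  have hLm : ∀ θ ∈ K, Measurable (L θ) := fun θ hθ => (hf_meas θ hθ).log
  have hq := hf_meas θ₀ hθ₀K
  have hq0 := hf_pos θ₀ hθ₀K
  have hνp := nu_prob μ (f θ₀) hq hq0 (hf_prob θ₀ hθ₀K)
  have hνae := nu_ae μ (f θ₀) hq hq0
  have hνint := nu_integral μ (f θ₀) hq hq0
  have hνi := nu_integrable μ (f θ₀) hq hq0
  have hgibbs : ∀ θ ∈ K, Integrable (fun x => L θ x - L θ₀ x)
      (μ.withDensity (fun x => ENNReal.ofReal (f θ₀ x))) → θ ≠ θ₀ →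
      ∫ x, (L θ x - L θ₀ x) ∂(μ.withDensity (fun x => ENNReal.ofReal (f θ₀ x))) < 0 := by
    intro θ hθ hi hne
    by_contra hc
    push Not at hc
    exact hne (hident θ hθ θ₀ hθ₀K (gibbs μ (f θ) (f θ₀) (hf_meas θ hθ) hq (hf_pos θ hθ) hq0
      (hf_prob θ hθ) (hf_prob θ₀ hθ₀K) hi hc))
  set ν := μ.withDensity (fun x => ENNReal.ofReal (f θ₀ x)) with hν
  obtain ⟨Hm, hHmm, hHm0, hHmH, hHmlip⟩ := lip_env K ⟨θ₀, hθ₀K⟩ L hLm H hH_nonneg hH_lip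
  have htr : ∀ g : 𝓧 → ℝ, Measurable g → Integrable (fun ω => g (X 0 ω)) P → Integrable g ν := by
    intro g hg hi
    rw [← hX_law 0]
    exact (integrable_map_measure hg.aestronglyMeasurable (hX_meas 0).aemeasurable).2 hi
  have hpull : ∀ (i : ℕ) (g : 𝓧 → ℝ), Measurable g → Integrable g ν →
      Integrable (fun ω => g (X i ω)) P := by
    intro i g hg hi
    rw [← hX_law i] at hi
    exact (integrable_map_measure hg.aestronglyMeasurable (hX_meas i).aemeasurable).1 hi
  have hpullint : ∀ (i : ℕ) (g : 𝓧 → ℝ), Measurable g →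
      ∫ ω, g (X i ω) ∂P = ∫ x, g x ∂ν := by
    intro i g hg
    rw [← hX_law i, integral_map (hX_meas i).aemeasurable hg.aestronglyMeasurable]
  have hexp : ∀ a : ℝ, 0 < a → Integrable (fun x => Real.exp (a * |Hm x|)) ν := by
    intro a ha
    refine htr _ (by fun_prop) ?_
    refine expInt_of_subG P (fun ω => Hm (X 0 ω)) (fun ω => H (X 0 ω))
      (hHmm.comp (hX_meas 0)).aemeasurable (ae_of_all _ fun ω => ?_) hH_subG a ha
    rw [abs_of_nonneg (hHm0 _), abs_of_nonneg (hH_nonneg _)]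
    exact hHmH _
  obtain ⟨δ0, hδ0, hball⟩ := Metric.isOpen_iff.1 hΘopen θ₀ hθ₀
  have hmemK : ∀ h, |h| < δ0 → θ₀ + h ∈ K := fun h hh => hΘK (hball (by
    rw [Metric.mem_ball, Real.dist_eq]; simpa using hh))
  obtain ⟨s0, d0, Q, hs0m, hd0m, hQm, hloc⟩ := local_env μ L Θ hΘopen θ₀ δ0 hδ0 hball
    (fun θ hθ => hLm θ (hΘK hθ)) (hf_smooth.mono fun x hx => ⟨hx.1, hx.2.1⟩) s hs Hbar hHbar_nonneg
    (fun x θ hθ => hHbar_lip x θ (hΘK hθ))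
  rw [← hνae] at hloc
  have hlocP : ∀ᵐ ω ∂P, d0 (X 0 ω) = deriv (fun t => s t (X 0 ω)) θ₀ ∧ 0 ≤ Q (X 0 ω) ∧
      Q (X 0 ω) ≤ Hbar (X 0 ω) := by
    have h2 : ∀ᵐ x ∂ν, d0 x = deriv (fun t => s t x) θ₀ ∧ 0 ≤ Q x ∧ Q x ≤ Hbar x :=
      hloc.mono fun x hx => ⟨hx.2.1, hx.2.2.1, hx.2.2.2.1⟩
    rw [← hX_law 0] at h2
    exact ae_of_ae_map (hX_meas 0).aemeasurable h2
  have hde : ∃ a > 0, Integrable (fun x => Real.exp (a * |d0 x|)) ν := by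
    obtain ⟨a, ha, hi⟩ := expInt_of_subE P (fun ω => d0 (X 0 ω)) _
      (hd0m.comp (hX_meas 0)).aemeasurable (hlocP.mono fun ω hω => by rw [hω.1]) hscore_subE
    exact ⟨a, ha, htr _ (by fun_prop) hi⟩
  have hQe : ∃ a > 0, Integrable (fun x => Real.exp (a * |Q x|)) ν := by
    obtain ⟨a, ha, hi⟩ := expInt_of_subE P (fun ω => Q (X 0 ω)) _
      (hQm.comp (hX_meas 0)).aemeasurable (hlocP.mono fun ω hω => by
        rw [abs_of_nonneg hω.2.1, abs_of_nonneg (hHbar_nonneg _)]; exact hω.2.2) hHbar_subE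
    exact ⟨a, ha, htr _ (by fun_prop) hi⟩
  have hdi := int_of_exp ν d0 hd0m hde
  have hQi := int_of_exp ν Q hQm hQe
  have hI : IFi = - ∫ x, d0 x ∂ν := by
    rw [hIFi, ← hνint]
    congr 1
    exact integral_congr_ae (hloc.mono fun x hx => hx.2.1.symm)
  have hHi : Integrable Hm ν := by
    simpa using pow_exp_int ν Hm hHmm hHm0 hexp 1 0 (by norm_num)
  obtain ⟨hsH, hs00, hs02⟩ := moments ν (fun h x => L (θ₀ + h) x - L θ₀ x) Hm s0 d0 Q hHmm hs0m hHm0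
    hd0m hexp hdi hQi δ0 hδ0 (fun h hh => (hLm _ (hmemK h hh)).sub (hLm _ hθ₀K))
    (by
      intro h hh
      rw [hνint, ← hf_prob _ (hmemK h hh)]
      refine integral_congr_ae (ae_of_all _ fun x => ?_)
      simp only [hL, Real.exp_sub, Real.exp_log (hf_pos _ (hmemK h hh) x), Real.exp_log (hq0 x)]
      exact div_mul_cancel₀ _ (hq0 x).ne')
    (by
      intro x h hh
      simpa using hHmlip x _ (hmemK h hh) _ hθ₀K)
    (hloc.mono fun x hx => ⟨hx.2.2.1, hx.2.2.2.2.2.2⟩)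
  rw [← hI] at hs02
  have hmax : ∀ n ω, 1 ≤ n → ∀ θ ∈ K, ∑ i ∈ Finset.range n, L θ (X i ω) ≤
      ∑ i ∈ Finset.range n, L (θhat n ω) (X i ω) := by
    intro n ω hn θ hθ
    have hn' : (0:ℝ) < n := by exact_mod_cast hn
    exact le_of_mul_le_mul_left (hθhat_max n ω θ hθ) (by positivity)
  have hneg : ∀ θ ∈ K, θ ≠ θ₀ → ∫ x, (L θ x - L θ₀ x) ∂ν < 0 := by
    intro θ hθ hne
    refine hgibbs θ hθ ?_ hne
    exact (hHi.mul_const |θ - θ₀|).mono' ((hLm θ hθ).sub (hLm θ₀ hθ₀K)).aestronglyMeasurable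
      (ae_of_all _ fun x => hHmlip x θ hθ θ₀ hθ₀K)
  have hcons := consist P ν X hX_meas hX_indep hX_law K hKcpt θ₀ hθ₀K L hLm Hm hHmm hHm0 hHmlip hexp
    hHi hneg θhat hθhat_mem (fun n ω hn => hmax n ω hn θ₀ hθ₀K)
  have hbad := bad_small P ν X hX_meas hX_indep hX_law K θ₀ δ0 hδ0 (hball.trans hΘK) L s s0 d0 Q
    hd0m hQm hde hQe hdi hQi IFi hI
    (hloc.mono fun x hx => ⟨hx.2.2.1, hx.2.2.2.2.1, hx.2.2.2.2.2.1⟩) θhat hmax hcons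
  have hpow : ∀ k : ℕ, 0 < k → Integrable (fun x => s0 x ^ k) ν := by
    intro k hk
    have i1 : Integrable (fun x => Hm x ^ k) ν := by
      simpa using pow_exp_int ν Hm hHmm hHm0 hexp k 0 (by simpa using hk)
    refine i1.mono' (by fun_prop) ?_
    filter_upwards [hsH] with x hx
    rw [Real.norm_eq_abs, abs_pow]
    gcongr
  have hUm : ∀ i, Measurable (fun ω => s0 (X i ω)) := fun i => hs0m.comp (hX_meas i)
  have hUi : iIndepFun (fun i ω => s0 (X i ω)) P := hX_indep.comp (fun _ => s0) (fun _ => hs0m)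
  have hUL : ∀ i, MemLp (fun ω => s0 (X i ω)) 2 P := fun i =>
    (memLp_two_iff_integrable_sq (hUm i).aestronglyMeasurable).2
      (hpull i (fun x => s0 x ^ 2) (by fun_prop) (hpow 2 (by norm_num)))
  have hU0 : ∀ i, ∫ ω, s0 (X i ω) ∂P = 0 := fun i => (hpullint i s0 hs0m).trans hs00
  have hU2 : ∀ i, ∫ ω, s0 (X i ω) ^ 2 ∂P = IFi := fun i =>
    (hpullint i (fun x => s0 x ^ 2) (by fun_prop)).trans hs02
  have hb : ∀ n ω, |θhat n ω - θ₀| ≤ 2 * B := by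
    intro n ω
    have h1 := hB _ (hθhat_mem n ω)
    have h2 := hB _ hθ₀K
    have := abs_sub (θhat n ω) θ₀
    linarith
  have hclose := l2_close P (fun i ω => s0 (X i ω)) hUm hUi hUL IFi hIFi_pos
    (∫ x, s0 x ^ 4 ∂ν) hU0 hU2
    (fun i => hpull i (fun x => s0 x ^ 4) (by fun_prop) (hpow 4 (by norm_num)))
    (fun i => hpullint i (fun x => s0 x ^ 4) (by fun_prop))
    (fun n ω => θhat n ω - θ₀) (fun n => (hθhat_meas n).sub_const _) (2 * B) hb hbad
  have hcI : (√IFi)⁻¹ ^ 2 * IFi = 1 := by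
    rw [inv_pow, Real.sq_sqrt hIFi_pos.le]
    exact inv_mul_cancel₀ hIFi_pos.ne'
  have hZm : ∀ n, Measurable (Z n) := by
    intro n
    have : Z n = fun ω => Real.sqrt (IFi * n) * (θhat n ω - θ₀) := funext (hZ n)
    rw [this]
    have := hθhat_meas n
    fun_prop
  refine assembly P (fun i ω => (√IFi)⁻¹ * s0 (X i ω))
    (hX_indep.comp (fun _ x => (√IFi)⁻¹ * s0 x) (fun _ => by fun_prop))
    (fun i => (hUL i).const_mul _) ?_ ?_ ?_ Z hZm ?_ ?_ G hG_meas hG_law hG_indep ε hε Ztil hZtil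
  · intro i
    rw [integral_const_mul, hU0, mul_zero]
  · intro i
    simp only [mul_pow]
    rw [integral_const_mul, hU2, hcI]
  · intro i
    have hid : IdentDistrib (X i) (X 0) P P :=
      ⟨(hX_meas i).aemeasurable, (hX_meas 0).aemeasurable, by rw [hX_law, hX_law]⟩
    exact hid.comp (u := fun x => (√IFi)⁻¹ * s0 x) (by fun_prop)
  · intro n
    refine MemLp.of_bound (hZm n).aestronglyMeasurable (Real.sqrt (IFi * n) * (2 * B))
      (ae_of_all _ fun ω => ?_)
    rw [hZ, norm_mul, Real.norm_eq_abs, Real.norm_eq_abs, abs_of_nonneg (Real.sqrt_nonneg _)]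
    exact mul_le_mul_of_nonneg_left (hb n ω) (Real.sqrt_nonneg _)
  · simp only [hZ]
    exact hclose
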